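/- arXiv:1103.1796 — 2 statements merged into one kernel-verified Lean document; each statement's English description precedes it below -/
import Mathlib

section
/- Let U' ⊆ U ⊆ ℂ be bounded open sets with closure(U') ⊆ U, let V ⊆ ℝ^{2n} be open, let 1 < p < ∞, and fix J₀ ∈ ℝ^{2n×2n} with J₀² = −Id. For every constant c₀ > 0 there exists a constant c > 0 such that the following holds. Let J : V → ℝ^{2n×2n} be Lipschitz with J(x)² = −Id for all x ∈ V and ‖J‖_{W^{1,∞}(V)} ≤ c₀, and define Φ : V → ℝ^{2n×2n} by Φ_x := ½(Id − J₀·J_x); then Φ_x ∘ J_x = J₀ ∘ Φ_x for every x ∈ V, and for every φ ∈ C¹(U, V) and every u ∈ C¹(U, ℝ^{2n}), writing J̃ := J∘φ: (∫_{U'} (|(Φ∘φ)·u|^p + |d((Φ∘φ)·u)|^p))^{1/p} ≤ c·[ (∫_U (|dφ|·|u|)^p)^{1/p} + (∫_U |∂_s u + J̃·∂_t u|^p)^{1/p} + (∫_U |u|^p)^{1/p} ], both sides interpreted in [0,∞]. -/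
open MeasureTheory Metric Complex Set
open scoped ENNReal Real Topology

noncomputable section

abbrev EV (n : ℕ) := EuclideanSpace ℝ (Fin (2 * n))

/-- The partial derivative in the `s`-direction (real direction) of `f : ℂ → F`. -/
def pds {F : Type*} [NormedAddCommGroup F] [NormedSpace ℝ F] (f : ℂ → F) (z : ℂ) : F :=
  fderiv ℝ f z 1

/-- The partial derivative in the `t`-direction (imaginary direction) of `f : ℂ → F`. -/
def pdt {F : Type*} [NormedAddCommGroup F] [NormedSpace ℝ F] (f : ℂ → F) (z : ℂ) : F :=
  fderiv ℝ f z Complex.I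

/-- The map `Φ_x = ½ (Id - J₀ J_x)` intertwining `J_x` and `J₀`. -/
def PhiMap {n : ℕ} (J₀ : EV n →L[ℝ] EV n) (J : EV n → (EV n →L[ℝ] EV n))
    (x : EV n) : EV n →L[ℝ] EV n :=
  (1 / 2 : ℝ) • (1 - J₀ * J x)

/-- Second-order Taylor lower bound with a second derivative bounded below by `k * (1 - s)`. -/
lemma taylor_lower_bound {φ φ' φ'' : ℝ → ℝ} {k : ℝ}
    (h1 : ∀ s ∈ Icc (0 : ℝ) 1, HasDerivAt φ (φ' s) s)
    (h2 : ∀ s ∈ Icc (0 : ℝ) 1, HasDerivAt φ' (φ'' s) s)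
    (h3 : ∀ s ∈ Icc (0 : ℝ) 1, k * (1 - s) ≤ φ'' s) :
    φ 0 + φ' 0 + k / 3 ≤ φ 1 := by
  have hP : ∀ s : ℝ, HasDerivAt (fun s : ℝ => k * (s - s ^ 2 / 2)) (k * (1 - s)) s := by
    intro s
    refine (((hasDerivAt_id' s).fun_sub
      (((hasDerivAt_id' s).fun_pow 2).div_const 2)).const_mul k).congr_deriv ?_
    norm_num
  have hQ : ∀ s : ℝ, HasDerivAt (fun s : ℝ => k * (s ^ 2 / 2 - s ^ 3 / 6) + φ' 0 * s)
      (k * (s - s ^ 2 / 2) + φ' 0) s := by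
    intro s
    refine ((((((hasDerivAt_id' s).fun_pow 2).div_const 2).fun_sub
      (((hasDerivAt_id' s).fun_pow 3).div_const 6)).const_mul k).fun_add
      ((hasDerivAt_id' s).const_mul (φ' 0))).congr_deriv ?_
    push_cast
    ring
  have mono1 : MonotoneOn (fun s => φ' s - k * (s - s ^ 2 / 2)) (Icc 0 1) := by
    apply monotoneOn_of_deriv_nonneg (convex_Icc 0 1)
    · intro s hs
      exact ((h2 s hs).sub (hP s)).continuousAt.continuousWithinAt
    · intro s hs
      rw [interior_Icc] at hs
      exact ((h2 s (Ioo_subset_Icc_self hs)).sub (hP s)).differentiableAt.differentiableWithinAt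
    · intro s hs
      rw [interior_Icc] at hs
      have hs' := Ioo_subset_Icc_self hs
      have := ((h2 s hs').sub (hP s)).deriv
      simp only [Pi.sub_def] at this
      rw [this]
      linarith [h3 s hs']
  have mono2 : MonotoneOn (fun s => φ s - (k * (s ^ 2 / 2 - s ^ 3 / 6) + φ' 0 * s))
      (Icc 0 1) := by
    apply monotoneOn_of_deriv_nonneg (convex_Icc 0 1)
    · intro s hs
      exact ((h1 s hs).sub (hQ s)).continuousAt.continuousWithinAt
    · intro s hs
      rw [interior_Icc] at hs
      exact ((h1 s (Ioo_subset_Icc_self hs)).sub (hQ s)).differentiableAt.differentiableWithinAt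
    · intro s hs
      rw [interior_Icc] at hs
      have hs' := Ioo_subset_Icc_self hs
      have := ((h1 s hs').sub (hQ s)).deriv
      simp only [Pi.sub_def] at this
      rw [this]
      have := mono1 (left_mem_Icc.2 zero_le_one) hs' hs'.1
      simp at this
      linarith
  have := mono2 (left_mem_Icc.2 zero_le_one) (right_mem_Icc.2 zero_le_one) zero_le_one
  simp at this
  linarith

/-- A convex function of Bellman type, whose Hessian dominates a multiple of `|dx||dy|`. -/
def bellman (p q x y : ℝ) : ℝ :=
  (x ^ p + y ^ q) + 1 / (20 * p) * (x ^ 2 * (x ^ p + y ^ q) ^ (1 - 2 / p))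

lemma bellman_continuous {p q : ℝ} (hp : 2 ≤ p) (hq : 0 ≤ q) :
    Continuous fun z : ℝ × ℝ => bellman p q z.1 z.2 := by
  have h1 : Continuous fun z : ℝ × ℝ => z.1 ^ p + z.2 ^ q :=
    ((Real.continuous_rpow_const (by linarith)).comp continuous_fst).add
      ((Real.continuous_rpow_const hq).comp continuous_snd)
  have hr : 0 ≤ 1 - 2 / p := by
    rw [sub_nonneg, div_le_one (by linarith)]; exact hp
  exact h1.add (((continuous_fst.pow 2).mul
    ((Real.continuous_rpow_const hr).comp h1)).const_mul _)

lemma bellman_nonneg {p q x y : ℝ} (hp : 2 ≤ p) (hx : 0 ≤ x) (hy : 0 ≤ y) :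
    0 ≤ bellman p q x y := by
  unfold bellman; positivity

lemma sq_mul_rpow_le {p x S : ℝ} (hp : 2 ≤ p) (hx : 0 ≤ x) (hS : x ^ p ≤ S) :
    x ^ 2 * S ^ (1 - 2 / p) ≤ S := by
  have hp0 : 0 < p := by linarith
  have hxp : 0 ≤ x ^ p := by positivity
  have hS0 : 0 ≤ S := hxp.trans hS
  have h1 : x ^ 2 ≤ S ^ (2 / p) := by
    calc x ^ 2 = (x ^ p) ^ (2 / p) := by
          rw [← Real.rpow_mul hx]; field_simp; norm_num
      _ ≤ S ^ (2 / p) := Real.rpow_le_rpow hxp hS (by positivity)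
  have hr : 0 ≤ 1 - 2 / p := by
    rw [sub_nonneg, div_le_one hp0]; exact hp
  calc x ^ 2 * S ^ (1 - 2 / p) ≤ S ^ (2 / p) * S ^ (1 - 2 / p) := by gcongr
    _ = S := by
      rw [← Real.rpow_add_of_nonneg hS0 (by positivity) hr]; simp

lemma bellman_le {p q x y : ℝ} (hp : 2 ≤ p) (hx : 0 ≤ x) (hy : 0 ≤ y) :
    bellman p q x y ≤ 2 * (x ^ p + y ^ q) := by
  have hyq : 0 ≤ y ^ q := by positivity
  have hxp : 0 ≤ x ^ p := by positivity
  have h1 := sq_mul_rpow_le (S := x ^ p + y ^ q) hp hx (by linarith)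
  have h2 : 1 / (20 * p) ≤ 1 := by
    rw [div_le_one (by linarith)]; linarith
  have h3 : 1 / (20 * p) * (x ^ 2 * (x ^ p + y ^ q) ^ (1 - 2 / p)) ≤ 1 * (x ^ p + y ^ q) := by
    gcongr
  unfold bellman; linarith

lemma bellman_zero {p q : ℝ} (hp : 2 ≤ p) (hq : 0 < q) : bellman p q 0 0 = 0 := by
  unfold bellman
  rw [Real.zero_rpow (by linarith), Real.zero_rpow hq.ne']; simp

/-- The pointwise lower bound for the Hessian of `bellman`, with the powers as variables. -/
lemma hessian_bound {p r S T x L G dx : ℝ} (hp : 2 ≤ p) (hr0 : 0 ≤ r) (hr1 : r ≤ 1)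
    (hS : 0 < S) (hT : 0 ≤ T) (hG : 0 ≤ G) (hxT : x ^ 2 * T ≤ S) (hL : L ^ 2 ≤ 2 * p * (S * G)) :
    G / 2 + 1 / (20 * p) * (T * dx ^ 2) ≤
      G + 1 / (20 * p) * (2 * dx ^ 2 * T + 4 * r * (x * dx * (T / S) * L)
        + r * (r - 1) * (x ^ 2 * (T / S ^ 2) * L ^ 2) + r * (x ^ 2 * (T / S) * G)) := by
  have e1 : 0 ≤ r * (x ^ 2 * (T / S) * G) := by positivity
  have hL2 : x ^ 2 * (T / S ^ 2) * L ^ 2 ≤ 2 * p * G := by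
    calc x ^ 2 * (T / S ^ 2) * L ^ 2 = (x ^ 2 * T) * L ^ 2 / S ^ 2 := by ring
      _ ≤ S * (2 * p * (S * G)) / S ^ 2 := by gcongr
      _ = 2 * p * G := by field_simp
  have hQ0 : 0 ≤ x ^ 2 * (T / S ^ 2) * L ^ 2 := by positivity
  have e2 : - (x ^ 2 * (T / S ^ 2) * L ^ 2) ≤ r * (r - 1) * (x ^ 2 * (T / S ^ 2) * L ^ 2) := by
    have h : -1 ≤ r * (r - 1) := by nlinarith
    linarith [mul_le_mul_of_nonneg_right h hQ0]
  have e3 : -(dx ^ 2 * T + 4 * (x ^ 2 * (T / S ^ 2) * L ^ 2)) ≤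
      4 * r * (x * dx * (T / S) * L) := by
    have : 0 ≤ T * (dx + 2 * r * (x * L / S)) ^ 2 := by positivity
    have h4 : T * (dx + 2 * r * (x * L / S)) ^ 2 = dx ^ 2 * T + 4 * r * (x * dx * (T / S) * L)
        + r ^ 2 * (4 * (x ^ 2 * (T / S ^ 2) * L ^ 2)) := by field_simp; ring
    have h5 : r ^ 2 * (4 * (x ^ 2 * (T / S ^ 2) * L ^ 2)) ≤ 1 * (4 * (x ^ 2 * (T / S ^ 2) * L ^ 2)) := by
      gcongr; nlinarith
    linarith
  have hd : 0 < 1 / (20 * p) := by positivity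
  have e4 : dx ^ 2 * T - 10 * p * G ≤ 2 * dx ^ 2 * T + 4 * r * (x * dx * (T / S) * L)
        + r * (r - 1) * (x ^ 2 * (T / S ^ 2) * L ^ 2) + r * (x ^ 2 * (T / S) * G) := by
    linarith
  have e5 := mul_le_mul_of_nonneg_left e4 hd.le
  have e6 : 1 / (20 * p) * (dx ^ 2 * T - 10 * p * G) = 1 / (20 * p) * (T * dx ^ 2) - G / 2 := by
    field_simp; ring
  linarith

set_option maxHeartbeats 1000000 in
lemma bellman_hessian_lower {p q : ℝ} (hp : 2 ≤ p) (hpq : p.HolderConjugate q) {κ : ℝ}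
    (hκ0 : 0 ≤ κ) (hκ1 : κ ≤ 1 / (20 * p)) (hκ2 : κ ≤ (q - 1) / 10) {y₀ X Y s dx dy S L G : ℝ}
    (hy₀ : 0 < y₀) (hxs : 0 < X) (hys : 0 < Y) (hs : s ∈ Icc (0 : ℝ) 1)
    (hyl : (1 - s) * y₀ ≤ Y) (hyu : Y ≤ 5 * y₀) (hSdef : S = X ^ p + Y ^ q)
    (hLdef : L = p * X ^ (p - 1) * dx + q * Y ^ (q - 1) * dy)
    (hGdef : G = p * (p - 1) * X ^ (p - 2) * dx ^ 2 + q * (q - 1) * Y ^ (q - 2) * dy ^ 2) :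
    κ * (y₀ ^ (2 - q) * dx ^ 2 + y₀ ^ (q - 2) * dy ^ 2) * (1 - s) ≤
      G + 1 / (20 * p) * (2 * dx ^ 2 * S ^ (1 - 2 / p)
        + 4 * (1 - 2 / p) * (X * dx * (S ^ (1 - 2 / p) / S) * L)
        + (1 - 2 / p) * ((1 - 2 / p) - 1) * (X ^ 2 * (S ^ (1 - 2 / p) / S ^ 2) * L ^ 2)
        + (1 - 2 / p) * (X ^ 2 * (S ^ (1 - 2 / p) / S) * G)) := by
  set δ : ℝ := 1 / (20 * p) with hδ
  set r : ℝ := 1 - 2 / p with hr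
  have hp0 : 0 < p := by linarith
  have hq0 : 0 < q := hpq.symm.pos
  have hq1 : 1 < q := hpq.symm.lt
  have hsum : p⁻¹ + q⁻¹ = 1 := hpq.inv_add_inv_eq_one
  have hr0 : 0 ≤ r := by
    rw [hr, sub_nonneg, div_le_one hp0]; exact hp
  have hr1 : r ≤ 1 := by
    have : 0 ≤ 2 / p := by positivity
    linarith
  have hmul : p * q = p + q := hpq.mul_eq_add
  have hq2 : q ≤ 2 := by nlinarith
  have hqr : q * r = 2 - q := by
    rw [hr]; field_simp; nlinarith
  have hδ0 : 0 < δ := by positivity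
  have hS : 0 < S := hSdef ▸ add_pos (Real.rpow_pos_of_pos hxs _) (Real.rpow_pos_of_pos hys _)
  have hG1 : 0 ≤ p * (p - 1) * X ^ (p - 2) * dx ^ 2 := by
    have : 0 ≤ p - 1 := by linarith
    positivity
  have hG2 : 0 ≤ q * (q - 1) * Y ^ (q - 2) * dy ^ 2 := by
    have : 0 ≤ q - 1 := by linarith
    positivity
  have hL : L ^ 2 ≤ 2 * p * (S * G) := by
    have l1 : (p * X ^ (p - 1) * dx) ^ 2 ≤
        p * (X ^ p * (p * (p - 1) * X ^ (p - 2) * dx ^ 2)) := by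
      have : (X ^ (p - 1)) ^ 2 = X ^ p * X ^ (p - 2) := by
        rw [← Real.rpow_add hxs, ← Real.rpow_natCast, ← Real.rpow_mul hxs.le]; congr 1
        push_cast; ring
      calc (p * X ^ (p - 1) * dx) ^ 2 = p ^ 2 * 1 * (X ^ p * X ^ (p - 2)) * dx ^ 2 := by
            rw [← this]; ring
        _ ≤ p ^ 2 * (p - 1) * (X ^ p * X ^ (p - 2)) * dx ^ 2 := by
            gcongr; linarith
        _ = _ := by ring
    have l2 : (q * Y ^ (q - 1) * dy) ^ 2 =
        p * (Y ^ q * (q * (q - 1) * Y ^ (q - 2) * dy ^ 2)) := by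
      have : (Y ^ (q - 1)) ^ 2 = Y ^ q * Y ^ (q - 2) := by
        rw [← Real.rpow_add hys, ← Real.rpow_natCast, ← Real.rpow_mul hys.le]; congr 1
        push_cast; ring
      have h3 : p * (q - 1) = q := by linarith
      calc (q * Y ^ (q - 1) * dy) ^ 2 = q * q * (Y ^ q * Y ^ (q - 2)) * dy ^ 2 := by
            rw [← this]; ring
        _ = (p * (q - 1)) * q * (Y ^ q * Y ^ (q - 2)) * dy ^ 2 := by rw [h3]
        _ = _ := by ring
    have hxp : 0 ≤ X ^ p := by positivity
    have hyq : 0 ≤ Y ^ q := by positivity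
    have l3 : L ^ 2 ≤ 2 * ((p * X ^ (p - 1) * dx) ^ 2 + (q * Y ^ (q - 1) * dy) ^ 2) := by
      rw [hLdef]
      nlinarith [sq_nonneg (p * X ^ (p - 1) * dx - q * Y ^ (q - 1) * dy)]
    have l4 : X ^ p * (p * (p - 1) * X ^ (p - 2) * dx ^ 2)
        + Y ^ q * (q * (q - 1) * Y ^ (q - 2) * dy ^ 2) ≤ S * G := by
      rw [hGdef]; nth_rewrite 1 [hSdef]
      nlinarith [mul_nonneg hxp hG2, mul_nonneg hyq hG1]
    nlinarith
  have hyq : 0 ≤ Y ^ q := by positivity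
  have hx2 : X ^ 2 * S ^ r ≤ S :=
    sq_mul_rpow_le hp hxs.le (by linarith)
  have key := hessian_bound (dx := dx) hp hr0 hr1 hS (Real.rpow_nonneg hS.le r)
    (hGdef ▸ add_nonneg hG1 hG2) hx2 hL
  refine le_trans ?_ key
  have hs1 : 0 ≤ 1 - s := by linarith [hs.2]
  have a1 : κ * (y₀ ^ (2 - q) * dx ^ 2) * (1 - s) ≤ δ * (S ^ r * dx ^ 2) := by
    have b1 : y₀ ^ (2 - q) * (1 - s) ≤ S ^ r := by
      calc y₀ ^ (2 - q) * (1 - s) ≤ y₀ ^ (2 - q) * (1 - s) ^ (2 - q) := by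
            gcongr
            calc 1 - s = (1 - s) ^ (1 : ℝ) := (Real.rpow_one _).symm
              _ ≤ _ := Real.rpow_le_rpow_of_exponent_ge' hs1 (by linarith [hs.1])
                (by linarith) (by linarith)
        _ = ((1 - s) * y₀) ^ (2 - q) := by
            rw [Real.mul_rpow hs1 hy₀.le]; ring
        _ ≤ (Y) ^ (2 - q) :=
            Real.rpow_le_rpow (by positivity) hyl (by linarith)
        _ = (Y ^ q) ^ r := by rw [← Real.rpow_mul hys.le, hqr]
        _ ≤ S ^ r := by
            refine Real.rpow_le_rpow hyq ?_ hr0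
            have : 0 ≤ X ^ p := by positivity
            linarith
    calc κ * (y₀ ^ (2 - q) * dx ^ 2) * (1 - s) = κ * ((y₀ ^ (2 - q) * (1 - s)) * dx ^ 2) := by
          ring
      _ ≤ δ * (S ^ r * dx ^ 2) := by gcongr
  have a2 : κ * (y₀ ^ (q - 2) * dy ^ 2) * (1 - s) ≤ G / 2 := by
    have b1 : y₀ ^ (q - 2) / 5 ≤ Y ^ (q - 2) := by
      calc y₀ ^ (q - 2) / 5 = (5 : ℝ) ^ (-1 : ℝ) * y₀ ^ (q - 2) := by
            rw [Real.rpow_neg_one]; ring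
        _ ≤ 5 ^ (q - 2) * y₀ ^ (q - 2) := by
            gcongr
            · norm_num
            · linarith
        _ = (5 * y₀) ^ (q - 2) := by rw [Real.mul_rpow (by norm_num) hy₀.le]
        _ ≤ Y ^ (q - 2) :=
            Real.rpow_le_rpow_of_nonpos hys hyu (by linarith)
    have b0 : 0 ≤ y₀ ^ (q - 2) := by positivity
    have hq10 : 0 ≤ q - 1 := by linarith
    calc κ * (y₀ ^ (q - 2) * dy ^ 2) * (1 - s)
        ≤ (q - 1) / 10 * (y₀ ^ (q - 2) * dy ^ 2) * 1 := by
          gcongr; linarith [hs.1]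
      _ = (1 * (q - 1) * (y₀ ^ (q - 2) / 5) * dy ^ 2) / 2 := by ring
      _ ≤ (q * (q - 1) * Y ^ (q - 2) * dy ^ 2) / 2 := by gcongr
      _ ≤ G / 2 := by linarith
  have := add_le_add a2 a1
  calc κ * (y₀ ^ (2 - q) * dx ^ 2 + y₀ ^ (q - 2) * dy ^ 2) * (1 - s)
      = κ * (y₀ ^ (q - 2) * dy ^ 2) * (1 - s) + κ * (y₀ ^ (2 - q) * dx ^ 2) * (1 - s) := by ring
    _ ≤ _ := this

set_option maxHeartbeats 1000000 in
lemma bellman_segment {p q : ℝ} (hp : 2 ≤ p) (hpq : p.HolderConjugate q) {κ : ℝ} (hκ0 : 0 ≤ κ)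
    (hκ1 : κ ≤ 1 / (20 * p)) (hκ2 : κ ≤ (q - 1) / 10) {x₀ y₀ : ℝ} (hx₀ : 0 < x₀) (hy₀ : 0 < y₀) :
    ∃ Gx Gy : ℝ, ∀ dx dy : ℝ, 0 < x₀ + dx → 0 < y₀ + dy → y₀ + dy ≤ 5 * y₀ →
      bellman p q x₀ y₀ + (Gx * dx + Gy * dy)
        + κ * (y₀ ^ (2 - q) * dx ^ 2 + y₀ ^ (q - 2) * dy ^ 2) / 3
        ≤ bellman p q (x₀ + dx) (y₀ + dy) := by
  set δ : ℝ := 1 / (20 * p) with hδ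
  set r : ℝ := 1 - 2 / p with hr
  have hp0 : 0 < p := by linarith
  have hq0 : 0 < q := hpq.symm.pos
  have hq1 : 1 < q := hpq.symm.lt
  have hsum : p⁻¹ + q⁻¹ = 1 := hpq.inv_add_inv_eq_one
  have hr0 : 0 ≤ r := by
    rw [hr, sub_nonneg, div_le_one hp0]; exact hp
  have hr1 : r ≤ 1 := by
    have : 0 ≤ 2 / p := by positivity
    linarith
  have hmul : p * q = p + q := hpq.mul_eq_add
  have hq2 : q ≤ 2 := by nlinarith
  have hqr : q * r = 2 - q := by
    rw [hr]; field_simp; nlinarith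
  have hδ0 : 0 < δ := by positivity
  refine ⟨p * x₀ ^ (p - 1) + δ * (2 * x₀ * (x₀ ^ p + y₀ ^ q) ^ r
      + x₀ ^ 2 * (r * (x₀ ^ p + y₀ ^ q) ^ (r - 1) * (p * x₀ ^ (p - 1)))),
    q * y₀ ^ (q - 1) + δ * (x₀ ^ 2 * (r * (x₀ ^ p + y₀ ^ q) ^ (r - 1) * (q * y₀ ^ (q - 1)))), ?_⟩
  intro dx dy hx1 hy1 hy5
  let x : ℝ → ℝ := fun s => x₀ + s * dx
  let y : ℝ → ℝ := fun s => y₀ + s * dy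
  let S : ℝ → ℝ := fun s => x s ^ p + y s ^ q
  let L : ℝ → ℝ := fun s => p * x s ^ (p - 1) * dx + q * y s ^ (q - 1) * dy
  let G : ℝ → ℝ := fun s => p * (p - 1) * x s ^ (p - 2) * dx ^ 2
    + q * (q - 1) * y s ^ (q - 2) * dy ^ 2
  have hx : ∀ s ∈ Icc (0 : ℝ) 1, 0 < x s := by
    intro s hs
    change 0 < x₀ + s * dx
    rcases hs with ⟨h0, h1⟩
    rcases h0.eq_or_lt with rfl | h0
    · simpa using hx₀
    · nlinarith [mul_pos h0 hx1, mul_nonneg (sub_nonneg.2 h1) hx₀.le]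
  have hyl : ∀ s ∈ Icc (0 : ℝ) 1, (1 - s) * y₀ ≤ y s := by
    intro s hs
    change (1 - s) * y₀ ≤ y₀ + s * dy
    rcases hs with ⟨h0, h1⟩
    nlinarith [mul_nonneg h0 hy1.le]
  have hy : ∀ s ∈ Icc (0 : ℝ) 1, 0 < y s := by
    intro s hs
    change 0 < y₀ + s * dy
    rcases hs with ⟨h0, h1⟩
    rcases h0.eq_or_lt with rfl | h0
    · simpa using hy₀
    · nlinarith [mul_pos h0 hy1, mul_nonneg (sub_nonneg.2 h1) hy₀.le]
  have hyu : ∀ s ∈ Icc (0 : ℝ) 1, y s ≤ 5 * y₀ := by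
    intro s hs
    change y₀ + s * dy ≤ 5 * y₀
    rcases hs with ⟨h0, h1⟩
    nlinarith
  have hS : ∀ s ∈ Icc (0 : ℝ) 1, 0 < S s := fun s hs =>
    add_pos (Real.rpow_pos_of_pos (hx s hs) _) (Real.rpow_pos_of_pos (hy s hs) _)
  have dX : ∀ s, HasDerivAt x dx s := fun s =>
    (((hasDerivAt_id' s).mul_const dx).const_add x₀).congr_deriv (one_mul dx)
  have dY : ∀ s, HasDerivAt y dy s := fun s =>
    (((hasDerivAt_id' s).mul_const dy).const_add y₀).congr_deriv (one_mul dy)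
  have dS : ∀ s ∈ Icc (0 : ℝ) 1, HasDerivAt S (L s) s := fun s hs => by
    refine (((dX s).rpow_const (p := p) (Or.inl (hx s hs).ne')).fun_add
      ((dY s).rpow_const (p := q) (Or.inl (hy s hs).ne'))).congr_deriv ?_
    simp only [L]; ring
  have dL : ∀ s ∈ Icc (0 : ℝ) 1, HasDerivAt L (G s) s := fun s hs => by
    refine (((((dX s).rpow_const (p := p - 1) (Or.inl (hx s hs).ne')).const_mul p).mul_const
      dx).fun_add ((((dY s).rpow_const (p := q - 1) (Or.inl (hy s hs).ne')).const_mul q).mul_const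
      dy)).congr_deriv ?_
    have e1 : p - 1 - 1 = p - 2 := by ring
    have e2 : q - 1 - 1 = q - 2 := by ring
    simp only [G, e1, e2]; ring
  let φ' : ℝ → ℝ := fun s => L s + δ * (2 * x s * dx * S s ^ r
    + x s ^ 2 * (L s * r * S s ^ (r - 1)))
  let φ'' : ℝ → ℝ := fun s => G s + δ * (2 * dx ^ 2 * S s ^ r
    + 4 * r * (x s * dx * (S s ^ r / S s) * L s)
    + r * (r - 1) * (x s ^ 2 * (S s ^ r / S s ^ 2) * L s ^ 2)
    + r * (x s ^ 2 * (S s ^ r / S s) * G s))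
  have d1 : ∀ s ∈ Icc (0 : ℝ) 1, HasDerivAt (fun s => bellman p q (x s) (y s)) (φ' s) s := by
    intro s hs
    refine ((dS s hs).fun_add ((((dX s).fun_pow 2).fun_mul
      ((dS s hs).rpow_const (p := r) (Or.inl (hS s hs).ne'))).const_mul δ)).congr_deriv ?_
    simp only [φ']; push_cast; ring
  have d2 : ∀ s ∈ Icc (0 : ℝ) 1, HasDerivAt φ' (φ'' s) s := by
    intro s hs
    have hs0 := hS s hs
    refine ((dL s hs).fun_add ((((((dX s).const_mul 2).mul_const dx).fun_mul
      ((dS s hs).rpow_const (p := r) (Or.inl hs0.ne'))).fun_add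
      (((dX s).fun_pow 2).fun_mul (((dL s hs).mul_const r).fun_mul
      ((dS s hs).rpow_const (p := r - 1) (Or.inl hs0.ne'))))).const_mul δ)).congr_deriv ?_
    have e1 : S s ^ (r - 1) = S s ^ r / S s := by
      rw [Real.rpow_sub_one hs0.ne']
    have e2 : S s ^ (r - 1 - 1) = S s ^ r / S s ^ 2 := by
      rw [Real.rpow_sub_one hs0.ne', e1]; field_simp
    rw [e2, e1]
    simp only [φ'']; push_cast; ring
  have hbound : ∀ s ∈ Icc (0 : ℝ) 1,
      κ * (y₀ ^ (2 - q) * dx ^ 2 + y₀ ^ (q - 2) * dy ^ 2) * (1 - s) ≤ φ'' s := by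
    intro s hs
    exact bellman_hessian_lower hp hpq hκ0 hκ1 hκ2 hy₀ (hx s hs) (hy s hs) hs (hyl s hs) (hyu s hs)
      rfl rfl rfl
  have := taylor_lower_bound d1 d2 hbound
  simp only [φ', L, S, x, y, zero_mul, one_mul, add_zero] at this
  refine le_trans (le_of_eq ?_) this
  ring

/-- The quantitative Jensen inequality for `bellman` on five points with equal weights. -/
lemma bellman_jensen {p q : ℝ} (hp : 2 ≤ p) (hpq : p.HolderConjugate q) :
    ∃ C > 0, ∀ x y : Fin 5 → ℝ, (∀ i, 0 ≤ x i) → (∀ i, 0 ≤ y i) → ∀ i j k l : Fin 5,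
      |x i - x j| * |y k - y l| ≤
        C * ((∑ i, bellman p q (x i) (y i)) / 5 - bellman p q ((∑ i, x i) / 5) ((∑ i, y i) / 5)) := by
  have hq1 : 1 < q := hpq.symm.lt
  set κ := min (1 / (20 * p)) ((q - 1) / 10) with hκ
  have hκ0 : 0 < κ := lt_min (by positivity) (by linarith)
  refine ⟨15 / κ, by positivity, ?_⟩
  -- the case of positive entries
  have hpos : ∀ x y : Fin 5 → ℝ, (∀ i, 0 < x i) → (∀ i, 0 < y i) → ∀ i j k l : Fin 5,
      |x i - x j| * |y k - y l| ≤ 15 / κ *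
        ((∑ i, bellman p q (x i) (y i)) / 5 - bellman p q ((∑ i, x i) / 5) ((∑ i, y i) / 5)) := by
    intro x y hx hy i j k l
    set X := (∑ i, x i) / 5 with hX
    set Y := (∑ i, y i) / 5 with hY
    have hX0 : 0 < X := div_pos (Finset.sum_pos (fun i _ => hx i) ⟨0, Finset.mem_univ _⟩) (by norm_num)
    have hY0 : 0 < Y := div_pos (Finset.sum_pos (fun i _ => hy i) ⟨0, Finset.mem_univ _⟩) (by norm_num)
    obtain ⟨Gx, Gy, hG⟩ := bellman_segment hp hpq hκ0.le (min_le_left _ _) (min_le_right _ _) hX0 hY0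
    have h1 : ∀ i, bellman p q X Y + (Gx * (x i - X) + Gy * (y i - Y))
        + κ * (Y ^ (2 - q) * (x i - X) ^ 2 + Y ^ (q - 2) * (y i - Y) ^ 2) / 3
        ≤ bellman p q (x i) (y i) := by
      intro i
      have := hG (x i - X) (y i - Y) (by linarith [hx i]) (by linarith [hy i]) (by
        have : y i ≤ ∑ i, y i := Finset.single_le_sum (fun i _ => (hy i).le) (Finset.mem_univ i)
        rw [hY]; linarith)
      simpa using this
    have h2 := Finset.sum_le_sum fun i (_ : i ∈ Finset.univ) => h1 i
    have sx : ∑ i, (x i - X) = 0 := by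
      rw [Finset.sum_sub_distrib]; simp [hX]; ring
    have sy : ∑ i, (y i - Y) = 0 := by
      rw [Finset.sum_sub_distrib]; simp [hY]; ring
    set P := Y ^ (2 - q) with hP
    set Q := Y ^ (q - 2) with hQ
    have hP0 : 0 < P := by positivity
    have hQ0 : 0 < Q := by positivity
    have hPQ : P * Q = 1 := by
      rw [hP, hQ, ← Real.rpow_add hY0]; simp
    have h3 : 5 * bellman p q X Y + κ / 3 * (P * ∑ i, (x i - X) ^ 2 + Q * ∑ i, (y i - Y) ^ 2)
        ≤ ∑ i, bellman p q (x i) (y i) := by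
      refine le_trans (le_of_eq ?_) h2
      rw [Finset.sum_add_distrib, Finset.sum_add_distrib, Finset.sum_add_distrib,
        ← Finset.mul_sum, ← Finset.mul_sum, sx, sy, ← Finset.sum_div, ← Finset.mul_sum,
        Finset.sum_add_distrib, ← Finset.mul_sum, ← Finset.mul_sum]
      simp; ring
    have pair : ∀ (z : Fin 5 → ℝ) (Z : ℝ) (i j : Fin 5),
        (z i - z j) ^ 2 ≤ 2 * ∑ i, (z i - Z) ^ 2 := by
      intro z Z i j
      rcases eq_or_ne i j with rfl | hij
      · have : 0 ≤ ∑ i, (z i - Z) ^ 2 := Finset.sum_nonneg fun i _ => sq_nonneg _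
        simpa using this
      · have : ∑ m ∈ ({i, j} : Finset (Fin 5)), (z m - Z) ^ 2 ≤ ∑ i, (z i - Z) ^ 2 :=
          Finset.sum_le_sum_of_subset_of_nonneg (Finset.subset_univ _) fun i _ _ => sq_nonneg _
        rw [Finset.sum_pair hij] at this
        nlinarith [sq_nonneg (z i - Z + (z j - Z))]
    have h4 : |x i - x j| * |y k - y l| ≤
        P * ∑ i, (x i - X) ^ 2 + Q * ∑ i, (y i - Y) ^ 2 := by
      have p1 := mul_le_mul_of_nonneg_left (pair x X i j) hP0.le
      have p2 := mul_le_mul_of_nonneg_left (pair y Y k l) hQ0.le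
      rw [← sq_abs] at p1 p2
      set A := |x i - x j|
      set B := |y k - y l|
      have h5 : 2 * (A * B) ≤ P * A ^ 2 + Q * B ^ 2 := by
        have e : P * (A - Q * B) ^ 2 = P * A ^ 2 - 2 * (P * Q) * (A * B) + (P * Q) * Q * B ^ 2 := by
          ring
        rw [hPQ] at e
        have : 0 ≤ P * (A - Q * B) ^ 2 := by positivity
        linarith
      linarith
    have h6 : P * ∑ i, (x i - X) ^ 2 + Q * ∑ i, (y i - Y) ^ 2 ≤
        3 / κ * (∑ i, bellman p q (x i) (y i) - 5 * bellman p q X Y) := by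
      rw [div_mul_eq_mul_div, le_div_iff₀ hκ0]
      linarith
    refine h4.trans (h6.trans (le_of_eq ?_))
    ring
  intro x y hx hy i j k l
  have hB := bellman_continuous (p := p) (q := q) hp (by linarith)
  have hlim : ContinuousWithinAt (fun ε : ℝ => 15 / κ *
      ((∑ i, bellman p q (x i + ε) (y i + ε)) / 5
        - bellman p q ((∑ i, (x i + ε)) / 5) ((∑ i, (y i + ε)) / 5))) (Ioi 0) 0 := by
    apply Continuous.continuousWithinAt
    refine continuous_const.mul (((continuous_finsetSum _ fun i _ => ?_).div_const _).sub ?_)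
    · exact hB.comp ((continuous_const.add continuous_id).prodMk (continuous_const.add continuous_id))
    · exact hB.comp (((continuous_finsetSum _ fun i _ => continuous_const.add continuous_id).div_const
        _).prodMk ((continuous_finsetSum _ fun i _ => continuous_const.add continuous_id).div_const _))
  have := ge_of_tendsto hlim (b := |x i - x j| * |y k - y l|) (by
    filter_upwards [self_mem_nhdsWithin] with ε hε
    have hε : 0 < ε := hε
    have := hpos (fun i => x i + ε) (fun i => y i + ε) (fun i => by linarith [hx i])
      (fun i => by linarith [hy i]) i j k l
    simpa using this)
  simpa using this

lemma exists_bellman {p q : ℝ} (hpq : p.HolderConjugate q) :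
    ∃ (B : ℝ → ℝ → ℝ) (C : ℝ), 0 < C ∧ (Continuous fun z : ℝ × ℝ => B z.1 z.2) ∧ B 0 0 = 0 ∧
      (∀ x y, 0 ≤ x → 0 ≤ y → 0 ≤ B x y ∧ B x y ≤ 2 * (x ^ p + y ^ q)) ∧
      ∀ x y : Fin 5 → ℝ, (∀ i, 0 ≤ x i) → (∀ i, 0 ≤ y i) → ∀ i j k l : Fin 5,
        |x i - x j| * |y k - y l| ≤
          C * ((∑ i, B (x i) (y i)) / 5 - B ((∑ i, x i) / 5) ((∑ i, y i) / 5)) := by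
  rcases le_total 2 p with hp | hp
  · obtain ⟨C, hC, h⟩ := bellman_jensen hp hpq
    exact ⟨bellman p q, C, hC, bellman_continuous hp hpq.symm.nonneg,
      bellman_zero hp hpq.symm.pos,
      fun x y hx hy => ⟨bellman_nonneg hp hx hy, bellman_le hp hx hy⟩, h⟩
  · have hq : 2 ≤ q := by
      have := hpq.mul_eq_add
      have := hpq.symm.pos
      nlinarith [hpq.lt]
    obtain ⟨C, hC, h⟩ := bellman_jensen hq hpq.symm
    refine ⟨fun x y => bellman q p y x, C, hC,
      (bellman_continuous hq hpq.nonneg).comp (continuous_snd.prodMk continuous_fst),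
      bellman_zero hq hpq.pos, fun x y hx hy => ⟨bellman_nonneg hq hy hx, ?_⟩, ?_⟩
    · have := bellman_le (q := p) hq hy hx
      linarith
    · intro x y hx hy i j k l
      rw [mul_comm]
      exact h y x hy hx k l i j

/-- Translation of functions on the plane. -/
def shift (c : ℂ) : Module.End ℝ (ℂ → ℝ) := LinearMap.funLeft ℝ ℝ fun x => x + c

@[simp] lemma shift_apply (c : ℂ) (f : ℂ → ℝ) (x : ℂ) : shift c f x = f (x + c) := rfl

lemma shift_mul (c d : ℂ) : shift c * shift d = shift (c + d) := by
  ext f x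
  simp [add_assoc]

lemma shift_commute (c d : ℂ) : Commute (shift c) (shift d) := by
  rw [Commute, SemiconjBy, shift_mul, shift_mul, add_comm]

/-- The five nodes of the lazy random walk. -/
def nodes (a b : ℂ) : Fin 5 → ℂ := ![0, 2 * a, -(2 * a), 2 * b, -(2 * b)]

/-- One step of the lazy random walk with steps `± 2 a`, `± 2 b`. -/
def walk (a b : ℂ) : Module.End ℝ (ℂ → ℝ) := (1 / 5 : ℝ) • ∑ i, shift (nodes a b i)

/-- The symmetric difference operator. -/
def cdiff (a : ℂ) : Module.End ℝ (ℂ → ℝ) := shift a - shift (-a)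

lemma walk_apply (a b : ℂ) (f : ℂ → ℝ) (x : ℂ) :
    walk a b f x = (∑ i, f (x + nodes a b i)) / 5 := by
  simp [walk, LinearMap.sum_apply, div_eq_inv_mul]

@[simp] lemma cdiff_apply (a : ℂ) (f : ℂ → ℝ) (x : ℂ) :
    cdiff a f x = f (x + a) - f (x - a) := by
  simp [cdiff, sub_eq_add_neg]

lemma shift_commute_walk (c a b : ℂ) : Commute (shift c) (walk a b) :=
  (Commute.sum_right _ _ _ fun _ _ => shift_commute _ _).smul_right _

lemma cdiff_commute_walk (c a b : ℂ) : Commute (cdiff c) (walk a b) :=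
  (shift_commute_walk _ _ _).sub_left (shift_commute_walk _ _ _)

lemma cdiff_commute (c d : ℂ) : Commute (cdiff c) (cdiff d) :=
  ((shift_commute _ _).sub_right (shift_commute _ _)).sub_left
    ((shift_commute _ _).sub_right (shift_commute _ _))

/-- Continuous functions with compact support. -/
def IsCc (f : ℂ → ℝ) : Prop := Continuous f ∧ HasCompactSupport f

namespace IsCc

variable {f g : ℂ → ℝ}

lemma integrable (hf : IsCc f) : Integrable f := hf.1.integrable_of_hasCompactSupport hf.2

lemma shift (hf : IsCc f) (c : ℂ) : IsCc (shift c f) :=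
  ⟨hf.1.comp (continuous_id.add continuous_const),
    hf.2.comp_homeomorph (Homeomorph.addRight c)⟩

lemma add (hf : IsCc f) (hg : IsCc g) : IsCc (f + g) := ⟨hf.1.add hg.1, hf.2.add hg.2⟩

lemma neg (hf : IsCc f) : IsCc (-f) := ⟨hf.1.neg, hf.2.comp_left (g := fun y => -y) neg_zero⟩

lemma sub (hf : IsCc f) (hg : IsCc g) : IsCc (f - g) := by
  rw [sub_eq_add_neg]; exact hf.add hg.neg

lemma smul (hf : IsCc f) (c : ℝ) : IsCc (c • f) :=
  ⟨hf.1.const_smul c, hf.2.comp_left (g := fun y => c • y) (smul_zero c)⟩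

lemma mul (hf : IsCc f) (hg : IsCc g) : IsCc (f * g) := ⟨hf.1.mul hg.1, hf.2.mul_right⟩

lemma comp (hf : IsCc f) {h : ℝ → ℝ} (hc : Continuous h) (h0 : h 0 = 0) :
    IsCc fun x => h (f x) := ⟨hc.comp hf.1, hf.2.comp_left h0⟩

lemma comp₂ (hf : IsCc f) (hg : IsCc g) {h : ℝ → ℝ → ℝ}
    (hc : Continuous fun z : ℝ × ℝ => h z.1 z.2) (h0 : h 0 0 = 0) :
    IsCc fun x => h (f x) (g x) :=
  ⟨hc.comp (hf.1.prodMk hg.1), hf.2.comp₂_left hg.2 h0⟩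

lemma walk (hf : IsCc f) (a b : ℂ) : IsCc (walk a b f) := by
  have h : ∀ s : Finset (Fin 5), IsCc (∑ i ∈ s, _root_.shift (nodes a b i) f) := fun s => by
    induction s using Finset.induction_on with
    | empty => exact ⟨continuous_const, HasCompactSupport.zero⟩
    | insert i s hi ih => rw [Finset.sum_insert hi]; exact (hf.shift _).add ih
  have := (h Finset.univ).smul (1 / 5)
  rwa [_root_.walk, LinearMap.smul_apply, LinearMap.sum_apply]

lemma walk_pow (hf : IsCc f) (a b : ℂ) (m : ℕ) : IsCc ((_root_.walk a b ^ m) f) := by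
  induction m with
  | zero => exact hf
  | succ m ih => rw [pow_succ']; exact ih.walk a b

lemma cdiff (hf : IsCc f) (a : ℂ) : IsCc (cdiff a f) := (hf.shift _).sub (hf.shift _)

lemma abs (hf : IsCc f) : IsCc fun x => |f x| := hf.comp continuous_abs abs_zero

lemma abs_rpow (hf : IsCc f) {p : ℝ} (hp : 0 < p) : IsCc fun x => |f x| ^ p :=
  hf.abs.comp (Real.continuous_rpow_const hp.le) (Real.zero_rpow hp.ne')

end IsCc

lemma integral_shift (c : ℂ) (f : ℂ → ℝ) : ∫ x, shift c f x = ∫ x, f x :=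
  integral_add_right_eq_self f c

lemma integral_walk {f : ℂ → ℝ} (hf : IsCc f) (a b : ℂ) : ∫ x, walk a b f x = ∫ x, f x := by
  simp_rw [walk_apply]
  rw [integral_div, integral_finsetSum (f := fun i x => f (x + nodes a b i)) _
    fun i _ => (hf.shift (nodes a b i)).integrable]
  simp_rw [integral_add_right_eq_self f]
  simp

lemma walk_nonneg {f : ℂ → ℝ} (hf : ∀ x, 0 ≤ f x) (a b : ℂ) (m : ℕ) :
    ∀ x, 0 ≤ (walk a b ^ m) f x := by
  induction m with
  | zero => exact hf
  | succ m ih =>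
    intro x
    rw [pow_succ', Module.End.mul_apply, walk_apply]
    exact div_nonneg (Finset.sum_nonneg fun i _ => ih _) (by norm_num)

lemma bilinear_bound_nonneg {p q : ℝ} (hpq : p.HolderConjugate q) :
    ∃ C > 0, ∀ (a b : ℂ) (f g : ℂ → ℝ), IsCc f → IsCc g → (∀ x, 0 ≤ f x) → (∀ x, 0 ≤ g x) →
      ∀ (K : ℕ) (i j k l : Fin 5), ∑ m ∈ Finset.range K,
        ∫ x, |(walk a b ^ m) f (x + nodes a b i) - (walk a b ^ m) f (x + nodes a b j)| *
          |(walk a b ^ m) g (x + nodes a b k) - (walk a b ^ m) g (x + nodes a b l)| ≤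
        C * ((∫ x, |f x| ^ p) + ∫ x, |g x| ^ q) := by
  obtain ⟨B, C, hC, hBc, hB0, hB, hJ⟩ := exists_bellman hpq
  refine ⟨2 * C, by positivity, ?_⟩
  intro a b f g hf hg hf0 hg0 K i j k l
  set F : ℕ → ℂ → ℝ := fun m => (walk a b ^ m) f with hF
  set G : ℕ → ℂ → ℝ := fun m => (walk a b ^ m) g with hG
  have cF : ∀ m, IsCc (F m) := fun m => hf.walk_pow a b m
  have cG : ∀ m, IsCc (G m) := fun m => hg.walk_pow a b m
  have pF : ∀ m x, 0 ≤ F m x := walk_nonneg hf0 a b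
  have pG : ∀ m x, 0 ≤ G m x := walk_nonneg hg0 a b
  have sF : ∀ m, F (m + 1) = walk a b (F m) := fun m => by
    simp only [hF, pow_succ', Module.End.mul_apply]
  have sG : ∀ m, G (m + 1) = walk a b (G m) := fun m => by
    simp only [hG, pow_succ', Module.End.mul_apply]
  set H : ℕ → ℂ → ℝ := fun m x => B (F m x) (G m x) with hH
  have cH : ∀ m, IsCc (H m) := fun m => (cF m).comp₂ (cG m) hBc hB0
  have step : ∀ m, ∫ x, |F m (x + nodes a b i) - F m (x + nodes a b j)| *
      |G m (x + nodes a b k) - G m (x + nodes a b l)| ≤ C * ((∫ x, H m x) - ∫ x, H (m + 1) x) := by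
    intro m
    rw [← integral_walk (cH m) a b, ← integral_sub ((cH m).walk a b).integrable (cH _).integrable,
      ← integral_const_mul]
    refine integral_mono ?_ ((((cH m).walk a b).sub (cH (m + 1))).smul C).integrable ?_
    · have c1 := (((cF m).shift (nodes a b i)).sub ((cF m).shift (nodes a b j))).abs
      have c2 := (((cG m).shift (nodes a b k)).sub ((cG m).shift (nodes a b l))).abs
      exact (c1.mul c2).integrable
    · intro x
      have := hJ (fun i => F m (x + nodes a b i)) (fun i => G m (x + nodes a b i))
        (fun i => pF _ _) (fun i => pG _ _) i j k l
      simpa only [hH, walk_apply, sF, sG] using this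
  have hsum := Finset.sum_le_sum fun m (_ : m ∈ Finset.range K) => step m
  rw [← Finset.mul_sum, Finset.sum_range_sub'] at hsum
  have hK : 0 ≤ ∫ x, H K x := integral_nonneg fun x => (hB _ _ (pF _ _) (pG _ _)).1
  have h0 : ∫ x, H 0 x ≤ 2 * ((∫ x, |f x| ^ p) + ∫ x, |g x| ^ q) := by
    rw [← integral_add (hf.abs_rpow hpq.pos).integrable (hg.abs_rpow hpq.symm.pos).integrable,
      ← integral_const_mul]
    refine integral_mono (cH 0).integrable
      (((hf.abs_rpow hpq.pos).add (hg.abs_rpow hpq.symm.pos)).smul 2).integrable fun x => ?_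
    have := (hB _ _ (hf0 x) (hg0 x)).2
    simpa [hH, hF, hG, abs_of_nonneg (hf0 x), abs_of_nonneg (hg0 x)] using this
  calc _ ≤ C * ((∫ x, H 0 x) - ∫ x, H K x) := hsum
    _ ≤ C * (2 * ((∫ x, |f x| ^ p) + ∫ x, |g x| ^ q)) := by gcongr; linarith
    _ = _ := by ring

lemma exists_nodes (a b s : ℂ) (hs : s = a ∨ s = b) (c : ℂ) :
    ∃ i, ∀ (h : ℂ → ℝ) (x : ℂ), cdiff s h (x + c) =
      shift (c - s) h (x + nodes a b i) - shift (c - s) h (x + nodes a b 0) := by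
  rcases hs with rfl | rfl
  · refine ⟨1, fun h x => ?_⟩
    simp only [cdiff_apply, shift_apply, nodes]
    congr 2 <;> simp <;> ring
  · refine ⟨3, fun h x => ?_⟩
    simp only [cdiff_apply, shift_apply, nodes]
    congr 2 <;> simp <;> ring

/-- The bilinear embedding estimate along the random walk. -/
lemma bilinear_bound {p q : ℝ} (hpq : p.HolderConjugate q) :
    ∃ C > 0, ∀ (a b : ℂ) (f g : ℂ → ℝ), IsCc f → IsCc g →
      ∀ (K : ℕ) (s t c : ℂ), (s = a ∨ s = b) → (t = a ∨ t = b) → ∑ m ∈ Finset.range K,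
        ∫ x, |cdiff s ((walk a b ^ m) f) (x + c)| * |cdiff t ((walk a b ^ m) g) x| ≤
        C * ((∫ x, |f x| ^ p) + ∫ x, |g x| ^ q) := by
  obtain ⟨C, hC, h⟩ := bilinear_bound_nonneg hpq
  have hC' : ∀ (a b : ℂ) (f g : ℂ → ℝ), IsCc f → IsCc g → (∀ x, 0 ≤ f x) → (∀ x, 0 ≤ g x) →
      ∀ (K : ℕ) (s t c : ℂ), (s = a ∨ s = b) → (t = a ∨ t = b) → ∑ m ∈ Finset.range K,
        ∫ x, |cdiff s ((walk a b ^ m) f) (x + c)| * |cdiff t ((walk a b ^ m) g) x| ≤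
        C * ((∫ x, |f x| ^ p) + ∫ x, |g x| ^ q) := by
    intro a b f g hf hg hf0 hg0 K s t c hs ht
    obtain ⟨i, hi⟩ := exists_nodes a b s hs c
    obtain ⟨k, hk⟩ := exists_nodes a b t ht 0
    have := h a b (shift (c - s) f) (shift (0 - t) g) (hf.shift _) (hg.shift _)
      (fun x => hf0 _) (fun x => hg0 _) K i 0 k 0
    have e1 : ∀ (c : ℂ) (f : ℂ → ℝ) (m : ℕ), (walk a b ^ m) (shift c f) =
        shift c ((walk a b ^ m) f) := fun c f m => by
      rw [← Module.End.mul_apply, ← Module.End.mul_apply,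
        ((shift_commute_walk c a b).pow_right m).eq]
    have e2 : ∀ (c : ℂ) (f : ℂ → ℝ) (p : ℝ), ∫ x, |shift c f x| ^ p = ∫ x, |f x| ^ p :=
      fun c f p => integral_shift c fun x => |f x| ^ p
    simp only [e1, e2, ← hi, ← hk, add_zero] at this
    exact this
  refine ⟨4 * C, by positivity, ?_⟩
  intro a b f g hf hg K s t c hs ht
  set fp : ℂ → ℝ := fun x => max (f x) 0 with hfp
  set fm : ℂ → ℝ := fun x => max (-f x) 0 with hfm
  set gp : ℂ → ℝ := fun x => max (g x) 0 with hgp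
  set gm : ℂ → ℝ := fun x => max (-g x) 0 with hgm
  have cfp : IsCc fp := hf.comp (h := fun y => max y 0) (by fun_prop) (by simp)
  have cfm : IsCc fm := hf.comp (h := fun y => max (-y) 0) (by fun_prop) (by simp)
  have cgp : IsCc gp := hg.comp (h := fun y => max y 0) (by fun_prop) (by simp)
  have cgm : IsCc gm := hg.comp (h := fun y => max (-y) 0) (by fun_prop) (by simp)
  have ef : f = fp - fm := by
    ext x; simp only [hfp, hfm, Pi.sub_apply]
    rcases le_total 0 (f x) with h | h <;> simp [h]
  have eg : g = gp - gm := by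
    ext x; simp only [hgp, hgm, Pi.sub_apply]
    rcases le_total 0 (g x) with h | h <;> simp [h]
  have hle : ∀ (u w : ℂ → ℝ) (p : ℝ), 0 < p → IsCc u → IsCc w → (∀ x, |w x| ≤ |u x|) →
      ∫ x, |w x| ^ p ≤ ∫ x, |u x| ^ p := by
    intro u w p hp hu hw huw
    exact integral_mono (hw.abs_rpow hp).integrable (hu.abs_rpow hp).integrable fun x =>
      Real.rpow_le_rpow (abs_nonneg _) (huw x) hp.le
  have hmax : ∀ y : ℝ, |max y 0| ≤ |y| := fun y => by
    rw [abs_of_nonneg (le_max_right _ _)]; exact max_le (le_abs_self _) (abs_nonneg _)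
  have hmax' : ∀ y : ℝ, |max (-y) 0| ≤ |y| := fun y => by
    rw [← abs_neg y]; exact hmax (-y)
  have i1 := hle f fp p hpq.pos hf cfp fun x => hmax _
  have i2 := hle f fm p hpq.pos hf cfm fun x => hmax' _
  have i3 := hle g gp q hpq.symm.pos hg cgp fun x => hmax _
  have i4 := hle g gm q hpq.symm.pos hg cgm fun x => hmax' _
  have p1 : ∀ x, 0 ≤ fp x := fun x => le_max_right _ _
  have p2 : ∀ x, 0 ≤ fm x := fun x => le_max_right _ _
  have p3 : ∀ x, 0 ≤ gp x := fun x => le_max_right _ _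
  have p4 : ∀ x, 0 ≤ gm x := fun x => le_max_right _ _
  have b1 := hC' a b fp gp cfp cgp p1 p3 K s t c hs ht
  have b2 := hC' a b fp gm cfp cgm p1 p4 K s t c hs ht
  have b3 := hC' a b fm gp cfm cgp p2 p3 K s t c hs ht
  have b4 := hC' a b fm gm cfm cgm p2 p4 K s t c hs ht
  have cI : ∀ (u w : ℂ → ℝ) (m : ℕ), IsCc u → IsCc w → Integrable fun x =>
      |cdiff s ((walk a b ^ m) u) (x + c)| * |cdiff t ((walk a b ^ m) w) x| :=
    fun u w m hu hw => ((((hu.walk_pow a b m).cdiff s).shift c).abs.mul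
      ((hw.walk_pow a b m).cdiff t).abs).integrable
  have hsplit : ∀ m, ∫ x, |cdiff s ((walk a b ^ m) f) (x + c)| * |cdiff t ((walk a b ^ m) g) x| ≤
      (∫ x, |cdiff s ((walk a b ^ m) fp) (x + c)| * |cdiff t ((walk a b ^ m) gp) x|)
      + (∫ x, |cdiff s ((walk a b ^ m) fp) (x + c)| * |cdiff t ((walk a b ^ m) gm) x|)
      + (∫ x, |cdiff s ((walk a b ^ m) fm) (x + c)| * |cdiff t ((walk a b ^ m) gp) x|)
      + ∫ x, |cdiff s ((walk a b ^ m) fm) (x + c)| * |cdiff t ((walk a b ^ m) gm) x| := by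
    intro m
    have I1 := cI fp gp m cfp cgp
    have I2 := cI fp gm m cfp cgm
    have I3 := cI fm gp m cfm cgp
    have I4 := cI fm gm m cfm cgm
    have hadd : ∀ {A B : ℂ → ℝ}, Integrable A → Integrable B → Integrable fun x => A x + B x :=
      fun h k => h.add k
    have I12 := hadd I1 I2
    have I123 := hadd I12 I3
    have I1234 := hadd I123 I4
    rw [← integral_add I1 I2, ← integral_add I12 I3, ← integral_add I123 I4]
    refine integral_mono (cI f g m hf hg) I1234 fun x => ?_
    beta_reduce
    rw [ef, eg, map_sub, map_sub, map_sub, map_sub, Pi.sub_apply, Pi.sub_apply]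
    calc _ ≤ (|cdiff s ((walk a b ^ m) fp) (x + c)| + |cdiff s ((walk a b ^ m) fm) (x + c)|) *
        (|cdiff t ((walk a b ^ m) gp) x| + |cdiff t ((walk a b ^ m) gm) x|) := by
          gcongr <;> exact abs_sub _ _
      _ = _ := by ring
  have := Finset.sum_le_sum fun m (_ : m ∈ Finset.range K) => hsplit m
  rw [Finset.sum_add_distrib, Finset.sum_add_distrib, Finset.sum_add_distrib] at this
  have j1 := mul_le_mul_of_nonneg_left i1 hC.le
  have j2 := mul_le_mul_of_nonneg_left i2 hC.le
  have j3 := mul_le_mul_of_nonneg_left i3 hC.le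
  have j4 := mul_le_mul_of_nonneg_left i4 hC.le
  linarith

lemma IsCc.integrable_mul {f g : ℂ → ℝ} (hf : IsCc f) (hg : IsCc g) :
    Integrable fun x => f x * g x := (hf.mul hg).integrable

lemma integral_cdiff_mul {f g : ℂ → ℝ} (hf : IsCc f) (hg : IsCc g) (a : ℂ) :
    ∫ x, cdiff a f x * g x = -∫ x, f x * cdiff a g x := by
  have h : ∀ c, ∫ x, shift c f x * g x = ∫ x, f x * shift (-c) g x := fun c => by
    rw [← integral_shift c fun x => f x * shift (-c) g x]
    simp
  have h1 : ∫ x, cdiff a f x * g x =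
      (∫ x, shift a f x * g x) - ∫ x, shift (-a) f x * g x := by
    rw [← integral_sub ((hf.shift a).integrable_mul hg) ((hf.shift (-a)).integrable_mul hg)]
    exact integral_congr_ae (.of_forall fun x => by simp [cdiff, sub_mul])
  have h2 : ∫ x, f x * cdiff a g x =
      (∫ x, f x * shift a g x) - ∫ x, f x * shift (-a) g x := by
    rw [← integral_sub (hf.integrable_mul (hg.shift a)) (hf.integrable_mul (hg.shift (-a)))]
    exact integral_congr_ae (.of_forall fun x => by simp [cdiff, mul_sub])
  rw [h1, h2, h, h, neg_neg]
  ring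

lemma cdiff_cdiff_apply (c : ℂ) (f : ℂ → ℝ) (x : ℂ) :
    cdiff c (cdiff c f) x = f (x + 2 * c) - 2 * f x + f (x + -(2 * c)) := by
  rw [cdiff_apply, cdiff_apply, cdiff_apply, show x + c + c = x + 2 * c by ring,
    show x - c - c = x + -(2 * c) by ring, add_sub_cancel_right, sub_add_cancel]
  ring

lemma walk_eq (a b : ℂ) : walk a b = 1 + (1 / 5 : ℝ) • (cdiff a * cdiff a + cdiff b * cdiff b) := by
  ext f x
  simp only [walk_apply, Fin.sum_univ_five, nodes, LinearMap.add_apply, LinearMap.smul_apply,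
    Pi.add_apply, Pi.smul_apply, Module.End.mul_apply, Module.End.one_apply, cdiff_cdiff_apply,
    smul_eq_mul, Matrix.cons_val, add_zero]
  ring

lemma integral_walk_mul {f g : ℂ → ℝ} (hf : IsCc f) (hg : IsCc g) (a b : ℂ) :
    ∫ x, walk a b f x * g x = ∫ x, f x * walk a b g x := by
  have key : ∀ {f g : ℂ → ℝ}, IsCc f → IsCc g → ∫ x, walk a b f x * g x =
      (∫ x, f x * g x) - (1 / 5) * ((∫ x, cdiff a f x * cdiff a g x) +
        ∫ x, cdiff b f x * cdiff b g x) := by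
    intro f g hf hg
    have h : ∀ c, ∫ x, cdiff c f x * cdiff c g x = -∫ x, cdiff c (cdiff c f) x * g x :=
      fun c => by rw [integral_cdiff_mul (hf.cdiff c) hg, neg_neg]
    have ha := ((hf.cdiff a).cdiff a).integrable_mul hg
    have hb := ((hf.cdiff b).cdiff b).integrable_mul hg
    have hab : Integrable fun x => cdiff a (cdiff a f) x * g x + cdiff b (cdiff b f) x * g x :=
      ha.add hb
    rw [h, h, ← neg_add, mul_neg, sub_neg_eq_add, ← integral_add ha hb, ← integral_const_mul,
      ← integral_add (hf.integrable_mul hg) (hab.const_mul _)]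
    refine integral_congr_ae (.of_forall fun x => ?_)
    simp only [walk_eq, LinearMap.add_apply, LinearMap.smul_apply,
      Pi.add_apply, Pi.smul_apply, Module.End.mul_apply, Module.End.one_apply, smul_eq_mul]
    ring
  have h1 := key hf hg
  have h2 := key hg hf
  simp only [mul_comm (walk a b g _), mul_comm (g _), mul_comm (cdiff _ g _)] at h2
  rw [h1, ← h2]

lemma integral_walk_pow_sq_le {g : ℂ → ℝ} (hg : IsCc g) (a b : ℂ) (k : ℕ) :
    ∫ x, (walk a b ^ k) g x ^ 2 ≤ ∫ x, g x ^ 2 := by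
  induction k with
  | zero => simp
  | succ k ih =>
    refine le_trans ?_ ih
    have hk := hg.walk_pow a b k
    have c2 : IsCc fun x => (walk a b ^ k) g x ^ 2 :=
      hk.comp (h := fun y => y ^ 2) (by fun_prop) (by simp)
    rw [← integral_walk c2 a b]
    refine integral_mono ((hg.walk_pow a b (k + 1)).comp (h := fun y => y ^ 2) (by fun_prop)
      (by simp)).integrable (c2.walk a b).integrable fun x => ?_
    beta_reduce
    rw [pow_succ' (walk a b), Module.End.mul_apply, walk_apply, walk_apply, div_pow]
    have := sq_sum_le_card_mul_sum_sq (s := Finset.univ)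
      (f := fun i => (walk a b ^ k) g (x + nodes a b i))
    simp only [Finset.card_univ, Fintype.card_fin] at this
    rw [div_le_div_iff₀ (by norm_num) (by norm_num)]
    push_cast at this
    linarith

lemma sum_integral_one_add_walk_le {p q : ℝ} (hpq : p.HolderConjugate q) :
    ∃ C > 0, ∀ (a b : ℂ) (f g : ℂ → ℝ), IsCc f → IsCc g →
      ∀ (K : ℕ) (s : ℂ), (s = a ∨ s = b) → ∑ m ∈ Finset.range K,
        |∫ x, (1 + walk a b) (cdiff s ((walk a b ^ m) f)) x * cdiff a ((walk a b ^ m) g) x| ≤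
        C * ((∫ x, |f x| ^ p) + ∫ x, |g x| ^ q) := by
  obtain ⟨C, hC, h⟩ := bilinear_bound hpq
  refine ⟨2 * C, by positivity, ?_⟩
  intro a b f g hf hg K s hs
  set R := C * ((∫ x, |f x| ^ p) + ∫ x, |g x| ^ q)
  have hb : ∀ c, ∑ m ∈ Finset.range K,
      ∫ x, |cdiff s ((walk a b ^ m) f) (x + c)| * |cdiff a ((walk a b ^ m) g) x| ≤ R :=
    fun c => h a b f g hf hg K s a c hs (.inl rfl)
  have cI : ∀ m c, Integrable fun x =>
      |cdiff s ((walk a b ^ m) f) (x + c)| * |cdiff a ((walk a b ^ m) g) x| :=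
    fun m c => ((((hf.walk_pow a b m).cdiff s).shift c).abs.mul
      ((hg.walk_pow a b m).cdiff a).abs).integrable
  have hm : ∀ m, |∫ x, (1 + walk a b) (cdiff s ((walk a b ^ m) f)) x *
      cdiff a ((walk a b ^ m) g) x| ≤
      (∫ x, |cdiff s ((walk a b ^ m) f) (x + 0)| * |cdiff a ((walk a b ^ m) g) x|) +
      (1 / 5) * ∑ i, ∫ x, |cdiff s ((walk a b ^ m) f) (x + nodes a b i)| *
        |cdiff a ((walk a b ^ m) g) x| := by
    intro m
    rw [← integral_finsetSum _ fun i _ => cI m (nodes a b i), ← integral_const_mul,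
      ← integral_add (cI m 0) ((integrable_finsetSum _ fun i _ => cI m _).const_mul _)]
    refine (abs_integral_le_integral_abs).trans (integral_mono ?_ ?_ fun x => ?_)
    · have c1 := (hf.walk_pow a b m).cdiff s
      exact ((c1.add (c1.walk a b)).mul ((hg.walk_pow a b m).cdiff a)).abs.integrable
    · exact (cI m 0).add ((integrable_finsetSum _ fun i _ => cI m _).const_mul _)
    · beta_reduce
      rw [abs_mul, ← Finset.sum_mul, ← mul_assoc, ← add_mul]
      gcongr
      simp only [LinearMap.add_apply, Module.End.one_apply, Pi.add_apply, walk_apply, add_zero]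
      refine (abs_add_le _ _).trans ?_
      gcongr
      rw [abs_div, abs_of_pos (show (0 : ℝ) < 5 by norm_num), div_eq_inv_mul, one_div]
      gcongr
      exact Finset.abs_sum_le_sum_abs _ _
  calc _ ≤ _ := Finset.sum_le_sum fun m _ => hm m
    _ ≤ R + (1 / 5) * ∑ i : Fin 5, R := by
      rw [Finset.sum_add_distrib, ← Finset.mul_sum, Finset.sum_comm]
      gcongr
      · exact hb 0
      · exact hb _
    _ = _ := by simp [R]; ring

lemma exists_dual_bound {p q : ℝ} (hpq : p.HolderConjugate q) :
    ∃ C > 0, ∀ (a b : ℂ) (v f₁ f₂ g : ℂ → ℝ), IsCc v → IsCc f₁ → IsCc f₂ → IsCc g →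
      cdiff a (cdiff a v) + cdiff b (cdiff b v) = cdiff a f₁ - cdiff b f₂ →
      ∫ x, cdiff a v x * g x ≤
        C * ((∫ x, |f₁ x| ^ p) + (∫ x, |f₂ x| ^ p) + ∫ x, |g x| ^ q) := by
  obtain ⟨C, hC, h⟩ := sum_integral_one_add_walk_le hpq
  obtain ⟨C₂, hC₂, h₂⟩ := bilinear_bound Real.HolderConjugate.two_two
  refine ⟨C, hC, ?_⟩
  intro a b v f₁ f₂ g hv hf₁ hf₂ hg heq
  set A := walk a b with hA
  set Θ : ℕ → ℝ := fun k => ∫ x, (A ^ k) (cdiff a v) x * (A ^ k) g x with hΘ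
  set S : (ℂ → ℝ) → ℂ → ℕ → ℝ := fun f s k =>
    ∫ x, (1 + A) (cdiff s ((A ^ k) f)) x * cdiff a ((A ^ k) g) x with hS
  have step : ∀ k, Θ k - Θ (k + 1) = (1 / 5) * (S f₁ a k - S f₂ b k) := by
    intro k
    have cF : IsCc ((A ^ k) (cdiff a v)) := (hv.cdiff a).walk_pow a b k
    have cg : IsCc ((A ^ k) g) := hg.walk_pow a b k
    have e1 : Θ (k + 1) = ∫ x, A (A ((A ^ k) (cdiff a v))) x * (A ^ k) g x := by
      simp only [hΘ]
      rw [integral_walk_mul (cF.walk a b) cg]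
      simp only [pow_succ', Module.End.mul_apply, hA]
    have c1 := ((hf₁.walk_pow a b k).cdiff a)
    have c1' : IsCc ((1 + A) (cdiff a ((A ^ k) f₁))) := c1.add (c1.walk a b)
    have c2 := ((hf₂.walk_pow a b k).cdiff b)
    have c2' : IsCc ((1 + A) (cdiff b ((A ^ k) f₂))) := c2.add (c2.walk a b)
    have op : (A ^ k) (cdiff a v) - A (A ((A ^ k) (cdiff a v))) =
        -((1 / 5 : ℝ) • cdiff a ((1 + A) (cdiff a ((A ^ k) f₁)) - (1 + A) (cdiff b ((A ^ k) f₂)))) := by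
      have hc : ∀ c, Commute (cdiff c) A := fun c => cdiff_commute_walk c a b
      have hck : ∀ c, Commute (cdiff c) (A ^ k) := fun c => (hc c).pow_right k
      have e2 : (1 + A) (cdiff a ((A ^ k) f₁)) - (1 + A) (cdiff b ((A ^ k) f₂)) =
          ((1 + A) * A ^ k) (cdiff a f₁ - cdiff b f₂) := by
        simp only [Module.End.mul_apply, map_sub]
        rw [← Module.End.mul_apply (cdiff a), (hck a).eq, ← Module.End.mul_apply (cdiff b),
          (hck b).eq, Module.End.mul_apply, Module.End.mul_apply]
      rw [e2, ← heq]
      have e3 : (1 / 5 : ℝ) • (cdiff a * cdiff a + cdiff b * cdiff b) = A - 1 := by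
        rw [hA, walk_eq, add_sub_cancel_left]
      have e4 : A ^ k * cdiff a - A * (A * (A ^ k * cdiff a)) =
          -((1 / 5 : ℝ) • (cdiff a * (((1 + A) * A ^ k) *
            (cdiff a * cdiff a + cdiff b * cdiff b)))) := by
        have hcc : Commute A (cdiff a * cdiff a + cdiff b * cdiff b) :=
          ((hc a).symm.mul_right (hc a).symm).add_right ((hc b).symm.mul_right (hc b).symm)
        have hcomm : Commute ((1 + A) * A ^ k) (cdiff a * cdiff a + cdiff b * cdiff b) :=
          ((Commute.one_left _).add_left hcc).mul_left (hcc.pow_left k)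
        have hcomm2 : Commute (cdiff a) ((1 + A) * A ^ k) :=
          ((Commute.one_right _).add_right (hc a)).mul_right (hck a)
        have hcomm3 : Commute (cdiff a) (cdiff a * cdiff a + cdiff b * cdiff b) :=
          ((Commute.refl _).mul_right (Commute.refl _)).add_right
            ((cdiff_commute a b).mul_right (cdiff_commute a b))
        rw [hcomm.eq, ← mul_assoc (cdiff a), hcomm3.eq, mul_assoc _ (cdiff a), hcomm2.eq, ← smul_mul_assoc, e3,
          mul_assoc (1 + A)]
        generalize A ^ k * cdiff a = X
        simp only [sub_mul, add_mul, mul_add, one_mul]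
        abel
      have := congrArg (fun T : Module.End ℝ (ℂ → ℝ) => T v) e4
      exact this
    rw [e1]
    have e5 : S f₁ a k - S f₂ b k = -∫ x, cdiff a ((1 + A) (cdiff a ((A ^ k) f₁)) -
        (1 + A) (cdiff b ((A ^ k) f₂))) x * (A ^ k) g x := by
      rw [integral_cdiff_mul (c1'.sub c2') cg, neg_neg, hS]
      beta_reduce
      rw [← integral_sub (c1'.integrable_mul (cg.cdiff a)) (c2'.integrable_mul (cg.cdiff a))]
      exact integral_congr_ae (.of_forall fun x => (sub_mul _ _ _).symm)
    rw [e5, hΘ]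
    beta_reduce
    rw [← integral_sub (cF.integrable_mul cg) (((cF.walk a b).walk a b).integrable_mul cg),
      mul_neg, ← integral_const_mul, ← integral_neg]
    refine integral_congr_ae (.of_forall fun x => ?_)
    have := congrFun op x
    simp only [Pi.sub_apply, Pi.neg_apply, Pi.smul_apply, smul_eq_mul] at this
    beta_reduce
    rw [← mul_assoc, ← neg_mul]
    rw [← this, sub_mul]
  set M := C * ((∫ x, |f₁ x| ^ p) + (∫ x, |f₂ x| ^ p) + ∫ x, |g x| ^ q) with hM
  have hgn : 0 ≤ ∫ x, |g x| ^ q := integral_nonneg fun x => Real.rpow_nonneg (abs_nonneg _) _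
  have hfn₁ : 0 ≤ ∫ x, |f₁ x| ^ p := integral_nonneg fun x => Real.rpow_nonneg (abs_nonneg _) _
  have hfn₂ : 0 ≤ ∫ x, |f₂ x| ^ p := integral_nonneg fun x => Real.rpow_nonneg (abs_nonneg _) _
  have hK : ∀ K, Θ 0 ≤ M + Θ K := by
    intro K
    have h1 := h a b f₁ g hf₁ hg K a (.inl rfl)
    have h2 := h a b f₂ g hf₂ hg K b (.inr rfl)
    have ht : Θ 0 - Θ K = ∑ k ∈ Finset.range K, (1 / 5) * (S f₁ a k - S f₂ b k) := by
      rw [← Finset.sum_range_sub']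
      exact Finset.sum_congr rfl fun k _ => step k
    have : Θ 0 - Θ K ≤ (1 / 5) * ((∑ k ∈ Finset.range K, |S f₁ a k|) +
        ∑ k ∈ Finset.range K, |S f₂ b k|) := by
      rw [ht, ← Finset.mul_sum, ← Finset.sum_add_distrib]
      gcongr with k
      have := le_abs_self (S f₁ a k)
      have := neg_abs_le (S f₂ b k)
      linarith
    have := mul_nonneg hC.le hgn
    have := mul_nonneg hC.le hfn₁
    have := mul_nonneg hC.le hfn₂
    simp only [hM]
    linarith
  set aK : ℕ → ℝ := fun k => ∫ x, (A ^ k) (cdiff a v) x ^ 2 with haK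
  have hcomm : ∀ k, (A ^ k) (cdiff a v) = cdiff a ((A ^ k) v) := fun k => by
    rw [← Module.End.mul_apply, ← ((cdiff_commute_walk a a b).pow_right k).eq,
      Module.End.mul_apply]
  have aK0 : Filter.Tendsto aK Filter.atTop (𝓝 0) := by
    refine Summable.tendsto_atTop_zero (summable_of_sum_range_le (c := C₂ * ((∫ x, |v x| ^ (2 : ℝ)) +
      ∫ x, |v x| ^ (2 : ℝ))) (fun k => integral_nonneg fun x => sq_nonneg _) fun K => ?_)
    have := h₂ a b v v hv hv K a a 0 (.inl rfl) (.inl rfl)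
    simpa [haK, hcomm, ← sq] using this
  have hE : ∀ ε > 0, Θ 0 ≤ M + ε * ∫ x, g x ^ 2 := by
    intro ε hε
    have hlim : Filter.Tendsto (fun k => M + (ε⁻¹ * aK k + ε * ∫ x, g x ^ 2)) Filter.atTop
        (𝓝 (M + (ε⁻¹ * 0 + ε * ∫ x, g x ^ 2))) :=
      tendsto_const_nhds.add ((aK0.const_mul _).add tendsto_const_nhds)
    rw [mul_zero, zero_add] at hlim
    refine ge_of_tendsto' hlim fun k => (hK k).trans ?_
    gcongr
    have cF : IsCc ((A ^ k) (cdiff a v)) := (hv.cdiff a).walk_pow a b k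
    have cg : IsCc ((A ^ k) g) := hg.walk_pow a b k
    have i1 := (cF.comp (h := fun y => y ^ 2) (by fun_prop) (by simp)).integrable
    have i2 := (cg.comp (h := fun y => y ^ 2) (by fun_prop) (by simp)).integrable
    calc Θ k ≤ ∫ x, (ε⁻¹ * (A ^ k) (cdiff a v) x ^ 2 + ε * (A ^ k) g x ^ 2) := by
          refine integral_mono (cF.mul cg).integrable ((i1.const_mul _).add (i2.const_mul _))
            fun x => ?_
          beta_reduce
          set y := (A ^ k) (cdiff a v) x
          set z := (A ^ k) g x
          have e : ε⁻¹ * y ^ 2 + ε * z ^ 2 - y * z =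
              ε⁻¹ * ((y - ε * z / 2) ^ 2 + 3 / 4 * (ε * z) ^ 2) := by field_simp; ring
          have : 0 ≤ ε⁻¹ * ((y - ε * z / 2) ^ 2 + 3 / 4 * (ε * z) ^ 2) := by positivity
          show y * z ≤ _
          linarith
      _ = ε⁻¹ * aK k + ε * ∫ x, (A ^ k) g x ^ 2 := by
          rw [integral_add (i1.const_mul _) (i2.const_mul _), integral_const_mul,
            integral_const_mul]
      _ ≤ _ := by have := integral_walk_pow_sq_le hg a b k; gcongr
  have hlim : Filter.Tendsto (fun ε : ℝ => M + ε * ∫ x, g x ^ 2) (𝓝[>] 0)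
      (𝓝 (M + 0 * ∫ x, g x ^ 2)) :=
    ((continuous_const.add (continuous_id.mul continuous_const)).tendsto 0).mono_left
      nhdsWithin_le_nhds
  rw [zero_mul, add_zero] at hlim
  exact ge_of_tendsto hlim (eventually_mem_nhdsWithin.mono fun ε hε => hE ε hε)

/-- The `L^p` bound for first differences of a solution of the discrete Poisson equation. -/
lemma exists_cdiff_bound {p : ℝ} (hp : 1 < p) :
    ∃ C > 0, ∀ (a b : ℂ) (v f₁ f₂ : ℂ → ℝ), IsCc v → IsCc f₁ → IsCc f₂ →
      cdiff a (cdiff a v) + cdiff b (cdiff b v) = cdiff a f₁ - cdiff b f₂ →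
      ∫ x, |cdiff a v x| ^ p ≤ C * ((∫ x, |f₁ x| ^ p) + ∫ x, |f₂ x| ^ p) := by
  have hpq := Real.HolderConjugate.conjExponent hp
  set q := p.conjExponent
  obtain ⟨C, hC, h⟩ := exists_dual_bound hpq
  set τ : ℝ := (2 * C) ^ (-(p - 1)) with hτ
  have hτ0 : 0 < τ := by positivity
  have hτq : C * τ ^ q = τ / 2 := by
    have : τ ^ q = τ * (2 * C)⁻¹ := by
      rw [hτ, ← Real.rpow_mul (by positivity), ← Real.rpow_neg_one (2 * C),
        ← Real.rpow_add (by positivity), neg_mul, hpq.sub_one_mul_conj]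
      congr 1; ring
    rw [this]; field_simp
  refine ⟨C * (2 / τ), by positivity, ?_⟩
  intro a b v f₁ f₂ hv hf₁ hf₂ heq
  set F := cdiff a v with hF
  have cF : IsCc F := hv.cdiff a
  set g : ℂ → ℝ := fun x => τ * ((max (F x) 0) ^ (p - 1) - (max (-F x) 0) ^ (p - 1)) with hg
  have cg : IsCc g := by
    refine cF.comp (h := fun y => τ * ((max y 0) ^ (p - 1) - (max (-y) 0) ^ (p - 1))) ?_ (by simp)
    have := Real.continuous_rpow_const (q := p - 1) (by linarith)
    exact continuous_const.mul ((this.comp (by fun_prop)).sub (this.comp (by fun_prop)))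
  have hp1 : p - 1 ≠ 0 := by linarith
  have key : ∀ y : ℝ, y * (τ * ((max y 0) ^ (p - 1) - (max (-y) 0) ^ (p - 1))) = τ * |y| ^ p ∧
      |τ * ((max y 0) ^ (p - 1) - (max (-y) 0) ^ (p - 1))| ^ q = τ ^ q * |y| ^ p := by
    have pos : ∀ y : ℝ, 0 ≤ y → y * y ^ (p - 1) = y ^ p := fun y hy => by
      conv_lhs => rw [← Real.rpow_one y, ← Real.rpow_mul hy, one_mul,
        ← Real.rpow_add_of_nonneg hy zero_le_one (by linarith)]
      congr 1; ring
    have posq : ∀ y : ℝ, 0 ≤ y → (τ * y ^ (p - 1)) ^ q = τ ^ q * y ^ p := fun y hy => by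
      rw [Real.mul_rpow hτ0.le (Real.rpow_nonneg hy _), ← Real.rpow_mul hy,
        hpq.sub_one_mul_conj]
    intro y
    rcases le_total 0 y with hy | hy
    · rw [max_eq_left hy, max_eq_right (by linarith), Real.zero_rpow hp1, sub_zero,
        abs_of_nonneg hy, abs_of_nonneg (by positivity)]
      exact ⟨by rw [← pos y hy]; ring, posq y hy⟩
    · have hy' : 0 ≤ -y := by linarith
      rw [max_eq_right hy, max_eq_left hy', Real.zero_rpow hp1, zero_sub, mul_neg, abs_neg,
        abs_of_nonpos hy, abs_of_nonneg (by positivity)]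
      exact ⟨by rw [← pos _ hy']; ring, posq _ hy'⟩
  have := h a b v f₁ f₂ g hv hf₁ hf₂ cg heq
  have e1 : ∫ x, F x * g x = τ * ∫ x, |F x| ^ p := by
    rw [← integral_const_mul]
    exact integral_congr_ae (.of_forall fun x => (key (F x)).1)
  have e2 : ∫ x, |g x| ^ q = τ ^ q * ∫ x, |F x| ^ p := by
    rw [← integral_const_mul]
    exact integral_congr_ae (.of_forall fun x => (key (F x)).2)
  rw [← hF, e1, e2, mul_add, ← mul_assoc C (τ ^ q), hτq] at this
  have h3 : τ / 2 * ∫ x, |F x| ^ p ≤ C * ((∫ x, |f₁ x| ^ p) + ∫ x, |f₂ x| ^ p) := by linarith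
  calc ∫ x, |F x| ^ p = (2 / τ) * (τ / 2 * ∫ x, |F x| ^ p) := by field_simp
    _ ≤ (2 / τ) * (C * ((∫ x, |f₁ x| ^ p) + ∫ x, |f₂ x| ^ p)) := by gcongr
    _ = _ := by ring

lemma norm_rpow_le_sum {ι : Type*} [Fintype ι] {p : ℝ} (hp : 1 ≤ p) (y : EuclideanSpace ℝ ι) :
    ‖y‖ ^ p ≤ (Fintype.card ι : ℝ) ^ (p - 1) * ∑ i, |y i| ^ p := by
  have h1 : ‖y‖ ≤ ∑ i, |y i| := by
    rw [EuclideanSpace.norm_eq]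
    refine (Real.sqrt_le_sqrt ?_).trans (Real.sqrt_sq (Finset.sum_nonneg fun i _ => abs_nonneg _)).le
    exact Finset.sum_sq_le_sq_sum_of_nonneg fun i _ => norm_nonneg _
  exact (Real.rpow_le_rpow (norm_nonneg _) h1 (by linarith)).trans
    (Real.rpow_sum_le_const_mul_sum_rpow _ _ hp)

set_option maxHeartbeats 1000000 in
/-- The discrete Calderón–Zygmund estimate for vector-valued functions. -/
lemma exists_difference_bound {ι : Type*} [Fintype ι] {p : ℝ} (hp : 1 < p)
    (J₀ : EuclideanSpace ℝ ι →L[ℝ] EuclideanSpace ℝ ι) (hJ₀ : J₀ * J₀ = -1) :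
    ∃ C > 0, ∀ (a b : ℂ) (v : ℂ → EuclideanSpace ℝ ι), Continuous v → HasCompactSupport v →
      ∫ x, ‖v (x + a) - v (x - a)‖ ^ p + ‖v (x + b) - v (x - b)‖ ^ p ≤
      C * ∫ x, ‖(v (x + a) - v (x - a)) + J₀ (v (x + b) - v (x - b))‖ ^ p := by
  obtain ⟨C, hC, h⟩ := exists_cdiff_bound hp
  have hp0 : 0 < p := by linarith
  set N : ℝ := (Fintype.card ι : ℝ) with hN
  refine ⟨1 + 2 * (N ^ (p - 1) * (N * (C * (1 + ‖J₀‖ ^ p)))), by positivity, ?_⟩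
  intro a b v hv hvs
  set f : ℂ → EuclideanSpace ℝ ι := fun x => (v (x + a) - v (x - a)) + J₀ (v (x + b) - v (x - b))
    with hf
  have cadd : ∀ c, Continuous (fun x => v (x + c)) ∧ HasCompactSupport fun x => v (x + c) :=
    fun c => ⟨hv.comp (continuous_id.add continuous_const),
      hvs.comp_homeomorph (Homeomorph.addRight c)⟩
  have cdif : ∀ c, Continuous (fun x => v (x + c) - v (x - c)) ∧
      HasCompactSupport fun x => v (x + c) - v (x - c) := fun c => by
    simp only [sub_eq_add_neg (_ : ℂ)]
    exact ⟨(cadd c).1.sub (cadd (-c)).1, (cadd c).2.sub (cadd (-c)).2⟩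
  have cf : Continuous f ∧ HasCompactSupport f :=
    ⟨(cdif a).1.add (J₀.continuous.comp (cdif b).1),
      (cdif a).2.add ((cdif b).2.comp_left (g := J₀) (map_zero _))⟩
  have cnorm : ∀ {g : ℂ → EuclideanSpace ℝ ι}, Continuous g ∧ HasCompactSupport g →
      Integrable fun x => ‖g x‖ ^ p := fun hg =>
    ((hg.1.norm).rpow_const fun _ => .inr hp0.le).integrable_of_hasCompactSupport
      (hg.2.comp_left (g := fun y => ‖y‖ ^ p) (by simp [hp0.ne']))
  set R := ∫ x, ‖f x‖ ^ p with hR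
  have hR0 : 0 ≤ R := integral_nonneg fun x => by positivity
  have comp : ∀ i, (∫ x, |(v (x + a) - v (x - a)) i| ^ p ≤ C * (1 + ‖J₀‖ ^ p) * R) ∧
      ∫ x, |(v (x + b) - v (x - b)) i| ^ p ≤ C * (1 + ‖J₀‖ ^ p) * R := by
    intro i
    set vi : ℂ → ℝ := fun x => v x i with hvi
    set wi : ℂ → ℝ := fun x => J₀ (v x) i with hwi
    have ci : Continuous fun y : EuclideanSpace ℝ ι => y i := by fun_prop
    have cvi : IsCc vi := ⟨ci.comp hv, hvs.comp_left (g := fun y : EuclideanSpace ℝ ι => y i) rfl⟩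
    have cwi : IsCc wi := ⟨ci.comp (J₀.continuous.comp hv),
      hvs.comp_left (g := fun y : EuclideanSpace ℝ ι => J₀ y i) (by simp)⟩
    set f₁ := cdiff a vi + cdiff b wi with hf₁
    set f₂ := cdiff a wi - cdiff b vi with hf₂
    have cf₁ : IsCc f₁ := (cvi.cdiff a).add (cwi.cdiff b)
    have cf₂ : IsCc f₂ := (cwi.cdiff a).sub (cvi.cdiff b)
    have hcomm : cdiff b (cdiff a wi) = cdiff a (cdiff b wi) := by
      rw [← Module.End.mul_apply, (cdiff_commute b a).eq, Module.End.mul_apply]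
    have hcomm' : cdiff b (cdiff a vi) = cdiff a (cdiff b vi) := by
      rw [← Module.End.mul_apply, (cdiff_commute b a).eq, Module.End.mul_apply]
    have e1 : cdiff a (cdiff a vi) + cdiff b (cdiff b vi) = cdiff a f₁ - cdiff b f₂ := by
      rw [hf₁, hf₂, map_add, map_sub, hcomm]; abel
    have e2 : cdiff b (cdiff b vi) + cdiff a (cdiff a vi) = cdiff b (-f₂) - cdiff a (-f₁) := by
      rw [map_neg, map_neg, sub_neg_eq_add, add_comm, e1]; abel
    have h1 := h a b vi f₁ f₂ cvi cf₁ cf₂ e1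
    have h2 := h b a vi (-f₂) (-f₁) cvi cf₂.neg cf₁.neg e2
    simp only [Pi.neg_apply, abs_neg] at h2
    have f₁_eq : ∀ x, f₁ x = f x i := fun x => by
      simp [hf₁, hf, hvi, hwi]
    have f₂_eq : ∀ x, f₂ x = J₀ (f x) i := fun x => by
      have : ∀ y, J₀ (J₀ y) = -y := fun y => by
        simpa using congrArg (fun T : EuclideanSpace ℝ ι →L[ℝ] EuclideanSpace ℝ ι => T y) hJ₀
      simp [hf₂, hf, hvi, hwi, this]
      ring
    have n1 : ∫ x, |f₁ x| ^ p ≤ R := by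
      refine integral_mono (cf₁.abs_rpow hp0).integrable (cnorm cf) fun x => ?_
      simp only [f₁_eq]
      exact Real.rpow_le_rpow (abs_nonneg _) (PiLp.norm_apply_le (f x) i) hp0.le
    have n2 : ∫ x, |f₂ x| ^ p ≤ ‖J₀‖ ^ p * R := by
      rw [hR, ← integral_const_mul]
      refine integral_mono (cf₂.abs_rpow hp0).integrable ((cnorm cf).const_mul _) fun x => ?_
      simp only [f₂_eq]
      rw [← Real.mul_rpow (norm_nonneg _) (norm_nonneg _)]
      exact Real.rpow_le_rpow (abs_nonneg _)
        ((PiLp.norm_apply_le (J₀ (f x)) i).trans (J₀.le_opNorm _)) hp0.le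
    have n3 : C * ((∫ x, |f₁ x| ^ p) + ∫ x, |f₂ x| ^ p) ≤ C * (1 + ‖J₀‖ ^ p) * R := by
      rw [mul_assoc]
      gcongr
      linarith
    refine ⟨?_, ?_⟩
    · refine le_trans (le_of_eq ?_) (h1.trans n3)
      simp [hvi]
    · rw [add_comm] at n3
      refine le_trans (le_of_eq ?_) (h2.trans (le_trans (le_of_eq (by ring)) n3))
      simp [hvi]
  have tot : ∀ c, (∀ i, ∫ x, |(v (x + c) - v (x - c)) i| ^ p ≤ C * (1 + ‖J₀‖ ^ p) * R) →
      ∫ x, ‖v (x + c) - v (x - c)‖ ^ p ≤ N ^ (p - 1) * (N * (C * (1 + ‖J₀‖ ^ p))) * R := by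
    intro c hc
    have ii : ∀ i, Integrable fun x => |(v (x + c) - v (x - c)) i| ^ p := fun i => by
      have ci : Continuous fun y : EuclideanSpace ℝ ι => y i := by fun_prop
      exact IsCc.integrable (IsCc.abs_rpow (f := fun x => (v (x + c) - v (x - c)) i)
        ⟨ci.comp (cdif c).1, (cdif c).2.comp_left (g := fun y : EuclideanSpace ℝ ι => y i) rfl⟩ hp0)
    calc _ ≤ ∫ x, N ^ (p - 1) * ∑ i, |(v (x + c) - v (x - c)) i| ^ p :=
          integral_mono (cnorm (cdif c)) ((integrable_finsetSum _ fun i _ => ii i).const_mul _)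
            fun x => norm_rpow_le_sum hp.le _
      _ = N ^ (p - 1) * ∑ i, ∫ x, |(v (x + c) - v (x - c)) i| ^ p := by
          rw [integral_const_mul, integral_finsetSum _ fun i _ => ii i]
      _ ≤ N ^ (p - 1) * ∑ _i : ι, C * (1 + ‖J₀‖ ^ p) * R :=
          mul_le_mul_of_nonneg_left (Finset.sum_le_sum fun i _ => hc i) (by positivity)
      _ = _ := by rw [Finset.sum_const, Finset.card_univ, nsmul_eq_mul]; ring
  rw [integral_add (cnorm (cdif a)) (cnorm (cdif b))]
  have t1 := tot a fun i => (comp i).1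
  have t2 := tot b fun i => (comp i).2
  linarith

/-- The symmetric difference quotient. -/
def symQuot {F : Type*} [NormedAddCommGroup F] [NormedSpace ℝ F] (v : ℂ → F) (e : ℂ) (k : ℕ)
    (x : ℂ) : F :=
  ((k + 1 : ℝ) / 2) • (v (x + ((k + 1 : ℝ)⁻¹ : ℝ) • e) - v (x - ((k + 1 : ℝ)⁻¹ : ℝ) • e))

lemma tendsto_symQuot {F : Type*} [NormedAddCommGroup F] [NormedSpace ℝ F] {v : ℂ → F} {x : ℂ}
    (hv : DifferentiableAt ℝ v x) (e : ℂ) :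
    Filter.Tendsto (fun k => symQuot v e k x) Filter.atTop (𝓝 (fderiv ℝ v x e)) := by
  have hn : Filter.Tendsto (fun k : ℕ => (k + 1 : ℝ)) Filter.atTop Filter.atTop :=
    tendsto_natCast_atTop_atTop.atTop_add tendsto_const_nhds
  have h1 := hv.hasFDerivAt.lim e (c := fun k : ℕ => (k + 1 : ℝ)) (l := Filter.atTop)
    (tendsto_norm_atTop_atTop.comp hn)
  have h2 := hv.hasFDerivAt.lim e (c := fun k : ℕ => -(k + 1 : ℝ)) (l := Filter.atTop)
    (by simp only [norm_neg]; exact tendsto_norm_atTop_atTop.comp hn)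
  have h3 := (h1.add h2).const_smul (1 / 2 : ℝ)
  rw [← two_smul ℝ (fderiv ℝ v x e), smul_smul, one_div, inv_mul_cancel₀ two_ne_zero,
    one_smul] at h3
  refine h3.congr fun k => ?_
  rw [symQuot, inv_neg, neg_smul, neg_smul, ← sub_eq_add_neg, ← sub_eq_add_neg]
  module

lemma norm_symQuot_le {F : Type*} [NormedAddCommGroup F] [NormedSpace ℝ F] {v : ℂ → F}
    {L : NNReal} (hv : LipschitzWith L v) (e : ℂ) (k : ℕ) (x : ℂ) :
    ‖symQuot v e k x‖ ≤ L * ‖e‖ := by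
  have hk : (0 : ℝ) < k + 1 := by positivity
  have := hv.norm_sub_le (x + ((k + 1 : ℝ)⁻¹ : ℝ) • e) (x - ((k + 1 : ℝ)⁻¹ : ℝ) • e)
  rw [symQuot, norm_smul, Real.norm_of_nonneg (by positivity)]
  rw [show x + ((k + 1 : ℝ)⁻¹ : ℝ) • e - (x - ((k + 1 : ℝ)⁻¹ : ℝ) • e) =
    ((2 * (k + 1 : ℝ)⁻¹ : ℝ)) • e by module, norm_smul, Real.norm_of_nonneg (by positivity)] at this
  calc _ ≤ ((k + 1 : ℝ) / 2) * (L * (2 * (k + 1 : ℝ)⁻¹ * ‖e‖)) := by gcongr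
    _ = _ := by field_simp

lemma continuous_symQuot {F : Type*} [NormedAddCommGroup F] [NormedSpace ℝ F] {v : ℂ → F}
    (hv : Continuous v) (e : ℂ) (k : ℕ) : Continuous (symQuot v e k) := by
  unfold symQuot
  fun_prop

/-- The constant-coefficient Calderón–Zygmund estimate for compactly supported Lipschitz maps. -/
lemma exists_fderiv_bound {ι : Type*} [Fintype ι] {p : ℝ} (hp : 1 < p)
    (J₀ : EuclideanSpace ℝ ι →L[ℝ] EuclideanSpace ℝ ι) (hJ₀ : J₀ * J₀ = -1) :
    ∃ C > 0, ∀ (L : NNReal) (v : ℂ → EuclideanSpace ℝ ι), LipschitzWith L v →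
      HasCompactSupport v →
      ∫⁻ x, ENNReal.ofReal (‖fderiv ℝ v x 1‖ ^ p + ‖fderiv ℝ v x I‖ ^ p) ≤
      ENNReal.ofReal C *
        ∫⁻ x, ENNReal.ofReal (‖fderiv ℝ v x 1 + J₀ (fderiv ℝ v x I)‖ ^ p) := by
  obtain ⟨C, hC, h⟩ := exists_difference_bound hp J₀ hJ₀
  have hp0 : 0 < p := by linarith
  refine ⟨C, hC, ?_⟩
  intro L v hL hs
  have hc := hL.continuous
  have hpc : ∀ {X : Type} [TopologicalSpace X] {g : X → EuclideanSpace ℝ ι}, Continuous g →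
      Continuous fun x => ‖g x‖ ^ p := fun hg => hg.norm.rpow_const fun _ => .inr hp0.le
  set Q := symQuot v with hQ
  have cQ : ∀ e k, Continuous (Q e k) := fun e k => continuous_symQuot hc e k
  set P : ℕ → ℂ → ℝ := fun k x => ‖Q 1 k x‖ ^ p + ‖Q I k x‖ ^ p with hP
  set D : ℕ → ℂ → ℝ := fun k x => ‖Q 1 k x + J₀ (Q I k x)‖ ^ p with hD
  have cP : ∀ k, Continuous (P k) := fun k => (hpc (cQ 1 k)).add (hpc (cQ I k))
  have cD : ∀ k, Continuous (D k) := fun k => hpc ((cQ 1 k).add (J₀.continuous.comp (cQ I k)))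
  have sQ : ∀ e : ℂ, ‖e‖ = 1 → ∀ k x, x ∉ cthickening 1 (tsupport v) → Q e k x = 0 := by
    intro e he k x hx
    have hk : ‖((k + 1 : ℝ)⁻¹ : ℝ) • e‖ ≤ 1 := by
      rw [norm_smul, he, mul_one, Real.norm_of_nonneg (by positivity)]
      exact inv_le_one_of_one_le₀ (by linarith [k.cast_nonneg (α := ℝ)])
    have key : ∀ d : ℂ, ‖d‖ ≤ 1 → v (x + d) = 0 := fun d hd => by
      refine image_eq_zero_of_notMem_tsupport fun hmem => hx ?_
      exact mem_cthickening_of_dist_le x (x + d) 1 _ hmem (by simpa [dist_eq_norm] using hd)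
    rw [hQ, symQuot, key _ hk, sub_eq_add_neg x, key _ (by rwa [norm_neg]), sub_zero, smul_zero]
  set K := cthickening 1 (tsupport v) with hK
  have cK : IsCompact K := IsCompact.cthickening hs
  have hP0 : ∀ k x, 0 ≤ P k x := fun k x => by positivity
  have hD0 : ∀ k x, 0 ≤ D k x := fun k x => by positivity
  have iP : ∀ k, Integrable (P k) := fun k =>
    (cP k).integrable_of_hasCompactSupport (HasCompactSupport.intro cK fun x hx => by
      simp [hP, sQ 1 norm_one k x hx, sQ I norm_I k x hx, hp0.ne'])
  have iD : ∀ k, Integrable (D k) := fun k =>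
    (cD k).integrable_of_hasCompactSupport (HasCompactSupport.intro cK fun x hx => by
      simp [hD, sQ 1 norm_one k x hx, sQ I norm_I k x hx, hp0.ne'])
  have step : ∀ k, ∫⁻ x, ENNReal.ofReal (P k x) ≤
      ENNReal.ofReal C * ∫⁻ x, ENNReal.ofReal (D k x) := by
    intro k
    rw [← ofReal_integral_eq_lintegral_ofReal (iP k) (.of_forall (hP0 k)),
      ← ofReal_integral_eq_lintegral_ofReal (iD k) (.of_forall (hD0 k)),
      ← ENNReal.ofReal_mul hC.le]
    refine ENNReal.ofReal_le_ofReal ?_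
    have hk : (0 : ℝ) ≤ (k + 1) / 2 := by positivity
    have := h (((k + 1 : ℝ)⁻¹ : ℝ) • 1) (((k + 1 : ℝ)⁻¹ : ℝ) • I) v hc hs
    have := mul_le_mul_of_nonneg_left this (Real.rpow_nonneg hk p)
    rw [← integral_const_mul, mul_left_comm, ← integral_const_mul] at this
    have e1 : ∀ x, P k x = ((k + 1 : ℝ) / 2) ^ p *
        (‖v (x + ((k + 1 : ℝ)⁻¹ : ℝ) • 1) - v (x - ((k + 1 : ℝ)⁻¹ : ℝ) • 1)‖ ^ p +
          ‖v (x + ((k + 1 : ℝ)⁻¹ : ℝ) • I) - v (x - ((k + 1 : ℝ)⁻¹ : ℝ) • I)‖ ^ p) := fun x => by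
      simp only [hP, hQ, symQuot, norm_smul, Real.norm_of_nonneg hk,
        Real.mul_rpow hk (norm_nonneg _), mul_add]
    have e2 : ∀ x, D k x = ((k + 1 : ℝ) / 2) ^ p *
        ‖v (x + ((k + 1 : ℝ)⁻¹ : ℝ) • 1) - v (x - ((k + 1 : ℝ)⁻¹ : ℝ) • 1) +
          J₀ (v (x + ((k + 1 : ℝ)⁻¹ : ℝ) • I) - v (x - ((k + 1 : ℝ)⁻¹ : ℝ) • I))‖ ^ p :=
      fun x => by
        simp only [hD, hQ, symQuot, map_smul, ← smul_add]
        rw [norm_smul, Real.norm_of_nonneg hk, Real.mul_rpow hk (norm_nonneg _)]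
    simpa only [← e1, ← e2] using this
  have hdiff : ∀ᵐ x, DifferentiableAt ℝ v x := hL.ae_differentiableAt
  have limP : ∀ᵐ x, Filter.Tendsto (fun k => ENNReal.ofReal (P k x)) Filter.atTop
      (𝓝 (ENNReal.ofReal (‖fderiv ℝ v x 1‖ ^ p + ‖fderiv ℝ v x I‖ ^ p))) := by
    filter_upwards [hdiff] with x hx
    refine ENNReal.tendsto_ofReal ?_
    exact ((tendsto_symQuot hx 1).norm.rpow_const (.inr hp0.le)).add
      ((tendsto_symQuot hx I).norm.rpow_const (.inr hp0.le))
  have limD : ∀ᵐ x, Filter.Tendsto (fun k => ENNReal.ofReal (D k x)) Filter.atTop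
      (𝓝 (ENNReal.ofReal (‖fderiv ℝ v x 1 + J₀ (fderiv ℝ v x I)‖ ^ p))) := by
    filter_upwards [hdiff] with x hx
    refine ENNReal.tendsto_ofReal ?_
    exact (((tendsto_symQuot hx 1).add ((J₀.continuous.tendsto _).comp
      (tendsto_symQuot hx I))).norm.rpow_const (.inr hp0.le))
  have intD : Filter.Tendsto (fun k => ∫⁻ x, ENNReal.ofReal (D k x)) Filter.atTop
      (𝓝 (∫⁻ x, ENNReal.ofReal (‖fderiv ℝ v x 1 + J₀ (fderiv ℝ v x I)‖ ^ p))) := by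
    refine tendsto_lintegral_of_dominated_convergence
      (K.indicator fun _ => ENNReal.ofReal ((L + ‖J₀‖ * L) ^ p))
      (fun k => (cD k).measurable.ennreal_ofReal) (fun k => .of_forall fun x => ?_) ?_ limD
    · by_cases hx : x ∈ K
      · simp only [indicator_of_mem hx]
        refine ENNReal.ofReal_le_ofReal (Real.rpow_le_rpow (norm_nonneg _) ?_ hp0.le)
        have h1 := norm_symQuot_le hL 1 k x
        have h2 := norm_symQuot_le hL I k x
        rw [norm_one, mul_one] at h1
        rw [norm_I, mul_one] at h2
        refine (norm_add_le _ _).trans (add_le_add h1 ((J₀.le_opNorm _).trans ?_))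
        gcongr
      · simp [hD, sQ 1 norm_one k x hx, sQ I norm_I k x hx, hp0.ne']
    · rw [lintegral_indicator cK.measurableSet, lintegral_const]
      simpa using ENNReal.mul_ne_top ENNReal.ofReal_ne_top cK.measure_lt_top.ne
  calc ∫⁻ x, ENNReal.ofReal (‖fderiv ℝ v x 1‖ ^ p + ‖fderiv ℝ v x I‖ ^ p)
      = ∫⁻ x, Filter.liminf (fun k => ENNReal.ofReal (P k x)) Filter.atTop :=
        lintegral_congr_ae (limP.mono fun x hx => hx.liminf_eq.symm)
    _ ≤ Filter.liminf (fun k => ∫⁻ x, ENNReal.ofReal (P k x)) Filter.atTop :=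
        lintegral_liminf_le fun k => (cP k).measurable.ennreal_ofReal
    _ ≤ Filter.liminf (fun k => ENNReal.ofReal C * ∫⁻ x, ENNReal.ofReal (D k x)) Filter.atTop :=
        Filter.liminf_le_liminf (.of_forall step)
    _ = _ := (ENNReal.Tendsto.const_mul intD (.inr ENNReal.ofReal_ne_top)).liminf_eq

lemma norm_fderiv_clm_apply_sub_le {E F G : Type*}
    [NormedAddCommGroup E] [NormedSpace ℝ E] [NormedAddCommGroup F] [NormedSpace ℝ F]
    [NormedAddCommGroup G] [NormedSpace ℝ G] {Ψ : E → F →L[ℝ] F} {u : E → F} {φ : E → G}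
    {z : E} {M : ℝ} (hu : DifferentiableAt ℝ u z) (hφ : DifferentiableAt ℝ φ z)
    (hv : DifferentiableAt ℝ (fun w => Ψ w (u w)) z)
    (hM : ∀ᶠ w in 𝓝 z, ‖Ψ w - Ψ z‖ ≤ M * ‖φ w - φ z‖) (e : E) :
    ‖fderiv ℝ (fun w => Ψ w (u w)) z e - Ψ z (fderiv ℝ u z e)‖ ≤
      M * ‖fderiv ℝ φ z e‖ * ‖u z‖ := by
  have hc : Filter.Tendsto (fun k : ℕ => ‖((k : ℝ) + 1)‖) Filter.atTop Filter.atTop := by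
    refine Filter.tendsto_atTop_mono (fun k => le_abs_self _) ?_
    exact Filter.tendsto_atTop_add_const_right _ _ tendsto_natCast_atTop_atTop
  have tv := hv.hasFDerivAt.lim e hc
  have tu := hu.hasFDerivAt.lim e hc
  have tφ := hφ.hasFDerivAt.lim e hc
  have hz : Filter.Tendsto (fun k : ℕ => z + ((k : ℝ) + 1)⁻¹ • e) Filter.atTop (𝓝 z) := by
    have : Filter.Tendsto (fun k : ℕ => ((k : ℝ) + 1)⁻¹) Filter.atTop (𝓝 0) := by
      simpa using tendsto_one_div_add_atTop_nhds_zero_nat (𝕜 := ℝ)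
    simpa using tendsto_const_nhds.add (this.smul_const e)
  have tuz := (hu.continuousAt.tendsto.comp hz).norm
  refine le_of_tendsto_of_tendsto (tv.sub (((Ψ z).continuous.tendsto _).comp tu)).norm
    (((tφ.norm).const_mul M).mul tuz) ?_
  filter_upwards [hz.eventually hM] with k hk
  have h0 : (0 : ℝ) ≤ k + 1 := by positivity
  have key : ((k : ℝ) + 1) • (Ψ (z + ((k : ℝ) + 1)⁻¹ • e) (u (z + ((k : ℝ) + 1)⁻¹ • e)) - Ψ z (u z)) -
      Ψ z (((k : ℝ) + 1) • (u (z + ((k : ℝ) + 1)⁻¹ • e) - u z)) =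
      ((k : ℝ) + 1) • ((Ψ (z + ((k : ℝ) + 1)⁻¹ • e) - Ψ z) (u (z + ((k : ℝ) + 1)⁻¹ • e))) := by
    rw [map_smul, ← smul_sub, map_sub, _root_.sub_apply]
    congr 1
    abel
  simp only [Function.comp_apply]
  rw [key, norm_smul, norm_smul, Real.norm_of_nonneg h0]
  calc _ ≤ ((k : ℝ) + 1) * ((M * ‖φ (z + ((k : ℝ) + 1)⁻¹ • e) - φ z‖) *
        ‖u (z + ((k : ℝ) + 1)⁻¹ • e)‖) := by
        gcongr
        exact ((Ψ (z + ((k : ℝ) + 1)⁻¹ • e) - Ψ z).le_opNorm _).trans (by gcongr)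
    _ = _ := by ring

lemma exists_smooth_cutoff {U' U : Set ℂ} (hb : Bornology.IsBounded U') (hU : IsOpen U)
    (hsub : closure U' ⊆ U) :
    ∃ χ : ℂ → ℝ, ContDiff ℝ 1 χ ∧ HasCompactSupport χ ∧ tsupport χ ⊆ U ∧
      (∀ x, χ x ∈ Icc (0 : ℝ) 1) ∧ ∀ x ∈ U', χ x = 1 := by
  have hK : IsCompact (closure U') := hb.isCompact_closure
  obtain ⟨δ, hδ, hδU⟩ := hK.exists_cthickening_subset_open hU hsub
  have hcl : IsClosed (cthickening δ (closure U')) := isClosed_cthickening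
  have hsi : closure U' ⊆ interior (cthickening δ (closure U')) :=
    (self_subset_thickening hδ _).trans
      (interior_maximal (thickening_subset_cthickening _ _) isOpen_thickening)
  obtain ⟨f, h1, h0, hI⟩ := exists_contMDiffMap_one_nhds_of_subset_interior (n := 1)
    (modelWithCornersSelf ℝ ℂ) isClosed_closure hsi
  have hts : tsupport f ⊆ cthickening δ (closure U') := by
    refine closure_minimal (fun x hx => ?_) hcl
    by_contra h
    exact hx (h0 x h)
  refine ⟨f, f.contMDiff.contDiff, ?_, hts.trans hδU, hI,
    fun x hx => (h1.self_of_nhdsSet) x (subset_closure hx)⟩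
  exact hK.cthickening.of_isClosed_subset (isClosed_tsupport _) hts

lemma LocallyLipschitz.exists_lipschitzWith_of_hasCompactSupport {F : Type*}
    [NormedAddCommGroup F] {v : ℂ → F} (hv : LocallyLipschitz v) (hs : HasCompactSupport v) :
    ∃ L : NNReal, LipschitzWith L v := by
  have hK : IsCompact (cthickening 1 (tsupport v)) := hs.isCompact.cthickening
  obtain ⟨L, hL⟩ := (hv.locallyLipschitzOn (s := cthickening 1 (tsupport v))).exists_lipschitzOnWith_of_compact hK
  obtain ⟨M, hM⟩ := hs.exists_bound_of_continuous hv.continuous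
  have hM0 : 0 ≤ M := (norm_nonneg _).trans (hM 0)
  have key : ∀ x y, y ∈ tsupport v → ‖v x - v y‖ ≤ (L + M.toNNReal : NNReal) * ‖x - y‖ := by
    intro x y hy
    rw [NNReal.coe_add, Real.coe_toNNReal _ hM0]
    by_cases hx : x ∈ cthickening 1 (tsupport v)
    · refine (hL.norm_sub_le hx (self_subset_cthickening _ hy)).trans ?_
      gcongr
      linarith
    · have hx0 : v x = 0 := image_eq_zero_of_notMem_tsupport fun h =>
        hx (self_subset_cthickening _ h)
      have hd : 1 ≤ ‖x - y‖ := by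
        by_contra! h
        exact hx (mem_cthickening_of_dist_le x y 1 _ hy (by rw [dist_eq_norm]; exact h.le))
      rw [hx0, zero_sub, norm_neg]
      nlinarith [hM y, L.coe_nonneg]
  refine ⟨L + M.toNNReal, lipschitzWith_iff_norm_sub_le.2 fun x y => ?_⟩
  by_cases hy : y ∈ tsupport v
  · exact key x y hy
  by_cases hx : x ∈ tsupport v
  · rw [norm_sub_rev, norm_sub_rev x y]
    exact key y x hx
  · rw [image_eq_zero_of_notMem_tsupport hx, image_eq_zero_of_notMem_tsupport hy, sub_zero,
      norm_zero]
    positivity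

lemma locallyLipschitzAt_clm_apply {E F : Type*}
    [NormedAddCommGroup E] [NormedSpace ℝ E] [NormedAddCommGroup F] [NormedSpace ℝ F]
    {Ψ : E → F →L[ℝ] F} {u : E → F} {z : E}
    (hΨ : ∃ K, ∃ t ∈ 𝓝 z, LipschitzOnWith K Ψ t) (hu : ContDiffAt ℝ 1 u z) :
    ∃ K, ∃ t ∈ 𝓝 z, LipschitzOnWith K (fun w => Ψ w (u w)) t := by
  obtain ⟨K, t, ht, hK⟩ := hΨ
  obtain ⟨K', t', ht', hK'⟩ := hu.exists_lipschitzOnWith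
  have hb : ContDiff ℝ 1 fun q : (F →L[ℝ] F) × F => q.1 q.2 :=
    isBoundedBilinearMap_apply.contDiff
  obtain ⟨K'', s, hs, hK''⟩ := hb.locallyLipschitz (Ψ z, u z)
  have hc : ContinuousAt (fun w => (Ψ w, u w)) z :=
    (hK.continuousOn.continuousAt ht).prodMk hu.continuousAt
  refine ⟨_, _, Filter.inter_mem (Filter.inter_mem ht ht') (hc.preimage_mem_nhds hs),
    hK''.comp (((hK.mono ?_).prodMk (hK'.mono ?_))) fun w hw => hw.2⟩
  · exact fun w hw => hw.1.1
  · exact fun w hw => hw.1.2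

lemma PhiMap_mul {n : ℕ} {J₀ : EV n →L[ℝ] EV n} (hJ₀ : J₀ * J₀ = -1)
    {J : EV n → (EV n →L[ℝ] EV n)} {x : EV n} (hJ : J x * J x = -1) :
    PhiMap J₀ J x * J x = J₀ * PhiMap J₀ J x := by
  ext1 y
  have h1 : J x (J x y) = -y := DFunLike.congr_fun hJ y
  have h2 : J₀ (J₀ (J x y)) = -J x y := DFunLike.congr_fun hJ₀ (J x y)
  simp [PhiMap, h1, h2, smul_sub, add_comm]

lemma norm_PhiMap_le {n : ℕ} (J₀ : EV n →L[ℝ] EV n) {J : EV n → (EV n →L[ℝ] EV n)}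
    {x : EV n} {c₀ : ℝ} (hJ : ‖J x‖ ≤ c₀) : ‖PhiMap J₀ J x‖ ≤ 1 + ‖J₀‖ * c₀ := by
  have h1 : ‖(1 : EV n →L[ℝ] EV n)‖ ≤ 1 := ContinuousLinearMap.norm_id_le
  have h2 : ‖J₀ * J x‖ ≤ ‖J₀‖ * c₀ := (norm_mul_le _ _).trans (by gcongr)
  have h3 := norm_sub_le (1 : EV n →L[ℝ] EV n) (J₀ * J x)
  rw [PhiMap, norm_smul, Real.norm_of_nonneg (by norm_num)]
  have := norm_nonneg ((1 : EV n →L[ℝ] EV n) - J₀ * J x)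
  linarith

lemma norm_PhiMap_sub_le {n : ℕ} (J₀ : EV n →L[ℝ] EV n) {J : EV n → (EV n →L[ℝ] EV n)}
    {V : Set (EV n)} {c₀ : ℝ} (hc₀ : 0 ≤ c₀) (hJ : LipschitzOnWith (Real.toNNReal c₀) J V)
    {x y : EV n} (hx : x ∈ V) (hy : y ∈ V) :
    ‖PhiMap J₀ J x - PhiMap J₀ J y‖ ≤ ‖J₀‖ * c₀ * ‖x - y‖ := by
  have e : PhiMap J₀ J x - PhiMap J₀ J y = (1 / 2 : ℝ) • (J₀ * (J y - J x)) := by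
    ext1 v
    change (1 / 2 : ℝ) • (v - J₀ (J x v)) - (1 / 2 : ℝ) • (v - J₀ (J y v)) =
      (1 / 2 : ℝ) • J₀ (J y v - J x v)
    rw [map_sub]
    module
  have h1 := hJ.norm_sub_le hy hx
  rw [Real.coe_toNNReal _ hc₀] at h1
  have h2 : ‖J₀ * (J y - J x)‖ ≤ ‖J₀‖ * (c₀ * ‖x - y‖) := by
    rw [norm_sub_rev x y]
    exact (norm_mul_le _ _).trans (by gcongr)
  rw [e, norm_smul, Real.norm_of_nonneg (by norm_num)]
  have := norm_nonneg (J₀ * (J y - J x))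
  linarith

lemma rpow_add_add_le {p : ℝ} (hp : 0 ≤ p) {a b c : ℝ} (ha : 0 ≤ a) (hb : 0 ≤ b) (hc : 0 ≤ c) :
    (a + b + c) ^ p ≤ 3 ^ p * (a ^ p + b ^ p + c ^ p) := by
  have key : ∀ m : ℝ, 0 ≤ m → a ≤ m → b ≤ m → c ≤ m → (a + b + c) ^ p ≤ 3 ^ p * m ^ p := by
    intro m hm h1 h2 h3
    rw [← Real.mul_rpow (by norm_num) hm]
    exact Real.rpow_le_rpow (by positivity) (by linarith) hp
  have h3 : (0 : ℝ) ≤ 3 ^ p := by positivity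
  have pa := Real.rpow_nonneg ha p
  have pb := Real.rpow_nonneg hb p
  have pc := Real.rpow_nonneg hc p
  rcases le_total a b with hab | hab <;> rcases le_total b c with hbc | hbc <;>
    rcases le_total a c with hac | hac
  all_goals
    first
    | exact (key c hc (by linarith) (by linarith) le_rfl).trans (by gcongr; linarith)
    | exact (key b hb (by linarith) le_rfl (by linarith)).trans (by gcongr; linarith)
    | exact (key a ha le_rfl (by linarith) (by linarith)).trans (by gcongr; linarith)

lemma sqrt_sq_add_sq_rpow_le {p : ℝ} (hp : 0 ≤ p) {a b : ℝ} (ha : 0 ≤ a) (hb : 0 ≤ b) :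
    Real.sqrt (a ^ 2 + b ^ 2) ^ p ≤ 3 ^ p * (a ^ p + b ^ p) := by
  have h : Real.sqrt (a ^ 2 + b ^ 2) ≤ a + b :=
    Real.sqrt_le_iff.2 ⟨by positivity, by nlinarith [mul_nonneg ha hb]⟩
  have h2 := rpow_add_add_le hp ha hb le_rfl
  by_cases h0 : p = 0
  · simp [h0]
  rw [Real.zero_rpow h0, add_zero, add_zero] at h2
  exact (Real.rpow_le_rpow (Real.sqrt_nonneg _) h hp).trans h2

/-- The pointwise bound for the constant-coefficient Cauchy-Riemann operator applied to a
twisted and cut off function. -/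
lemma norm_dbar_PhiMap_le {n : ℕ} {J₀ : EV n →L[ℝ] EV n} (hJ₀ : J₀ * J₀ = -1)
    {J : EV n → (EV n →L[ℝ] EV n)} {V : Set (EV n)} {U : Set ℂ} (hU : IsOpen U)
    {c₀ Cχ : ℝ} (hc₀ : 0 ≤ c₀)
    (hJ : ∀ x ∈ V, J x * J x = -1) (hJb : ∀ x ∈ V, ‖J x‖ ≤ c₀)
    (hJL : LipschitzOnWith (Real.toNNReal c₀) J V)
    {φ u : ℂ → EV n} (hφ : ContDiffOn ℝ 1 φ U) (hφV : MapsTo φ U V) (hu : ContDiffOn ℝ 1 u U)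
    {χ : ℂ → ℝ} (hχ : ContDiff ℝ 1 χ) (hχI : ∀ x, χ x ∈ Icc (0 : ℝ) 1)
    (hCχ : ∀ x, ‖fderiv ℝ χ x‖ ≤ Cχ) {z : ℂ} (hz : z ∈ U)
    (hv : DifferentiableAt ℝ (fun w => PhiMap J₀ J (φ w) (χ w • u w)) z) :
    ‖pds (fun w => PhiMap J₀ J (φ w) (χ w • u w)) z +
        J₀ (pdt (fun w => PhiMap J₀ J (φ w) (χ w • u w)) z)‖ ≤
      (‖J₀‖ * c₀ * (1 + ‖J₀‖) + (1 + ‖J₀‖ * c₀) * (1 + Cχ * (1 + c₀))) *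
        (Real.sqrt (‖pds φ z‖ ^ 2 + ‖pdt φ z‖ ^ 2) * ‖u z‖ +
          ‖pds u z + J (φ z) (pdt u z)‖ + ‖u z‖) := by
  have hUz : U ∈ 𝓝 z := hU.mem_nhds hz
  have dφ : DifferentiableAt ℝ φ z := (hφ.contDiffAt hUz).differentiableAt one_ne_zero
  have du : DifferentiableAt ℝ u z := (hu.contDiffAt hUz).differentiableAt one_ne_zero
  have dχ : DifferentiableAt ℝ χ z := hχ.contDiffAt.differentiableAt one_ne_zero
  have dχu : DifferentiableAt ℝ (fun w => χ w • u w) z := dχ.smul du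
  have hM : ∀ᶠ w in 𝓝 z, ‖PhiMap J₀ J (φ w) - PhiMap J₀ J (φ z)‖ ≤
      ‖J₀‖ * c₀ * ‖φ w - φ z‖ := by
    filter_upwards [hUz] with w hw
    exact norm_PhiMap_sub_le J₀ hc₀ hJL (hφV hw) (hφV hz)
  have A := fun e => norm_fderiv_clm_apply_sub_le dχu dφ hv hM e
  have hfd : ∀ e, fderiv ℝ (fun w => χ w • u w) z e =
      χ z • fderiv ℝ u z e + (fderiv ℝ χ z e) • u z := fun e => by
    rw [show (fun w => χ w • u w) = χ • u from rfl, fderiv_smul dχ du]; simp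
  have hχ0 := (hχI z).1
  have hχ1 := (hχI z).2
  have hCχ0 : 0 ≤ Cχ := (norm_nonneg _).trans (hCχ z)
  have hχu : ‖χ z • u z‖ ≤ ‖u z‖ := by
    rw [norm_smul, Real.norm_of_nonneg hχ0]
    exact mul_le_of_le_one_left (norm_nonneg _) hχ1
  have hχd : ∀ e : ℂ, ‖e‖ = 1 → ‖fderiv ℝ χ z e‖ ≤ Cχ := fun e he =>
    ((fderiv ℝ χ z).le_opNorm e).trans (by rw [he, mul_one]; exact hCχ z)
  set v := fun w => PhiMap J₀ J (φ w) (χ w • u w)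
  set P := PhiMap J₀ J (φ z) with hP
  set S := Real.sqrt (‖pds φ z‖ ^ 2 + ‖pdt φ z‖ ^ 2) with hS
  have hS1 : ‖fderiv ℝ φ z 1‖ ≤ S :=
    Real.le_sqrt_of_sq_le (le_add_of_nonneg_right (sq_nonneg _))
  have hS2 : ‖fderiv ℝ φ z I‖ ≤ S :=
    Real.le_sqrt_of_sq_le (le_add_of_nonneg_left (sq_nonneg _))
  have A' : ∀ e, ‖fderiv ℝ φ z e‖ ≤ S →
      ‖fderiv ℝ v z e - P (fderiv ℝ (fun w => χ w • u w) z e)‖ ≤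
        ‖J₀‖ * c₀ * (S * ‖u z‖) := fun e he => by
    refine (A e).trans ?_
    rw [mul_assoc]
    gcongr
  have hPJ : ∀ y, J₀ (P y) = P (J (φ z) y) := fun y =>
    (DFunLike.congr_fun (PhiMap_mul hJ₀ (hJ _ (hφV hz))) y).symm
  have dec : pds v z + J₀ (pdt v z) =
      (fderiv ℝ v z 1 - P (fderiv ℝ (fun w => χ w • u w) z 1)) +
      J₀ (fderiv ℝ v z I - P (fderiv ℝ (fun w => χ w • u w) z I)) +
      P (χ z • (pds u z + J (φ z) (pdt u z)) +
        (fderiv ℝ χ z 1 • u z + fderiv ℝ χ z I • J (φ z) (u z))) := by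
    simp only [pds, pdt, hfd, map_sub, map_add, map_smul, hPJ, smul_add]
    abel
  have n1 := A' 1 hS1
  have n2 : ‖J₀ (fderiv ℝ v z I - P (fderiv ℝ (fun w => χ w • u w) z I))‖ ≤
      ‖J₀‖ * (‖J₀‖ * c₀ * (S * ‖u z‖)) :=
    (J₀.le_opNorm _).trans (by gcongr; exact A' I hS2)
  have n3 : ‖χ z • (pds u z + J (φ z) (pdt u z)) +
        (fderiv ℝ χ z 1 • u z + fderiv ℝ χ z I • J (φ z) (u z))‖ ≤
      ‖pds u z + J (φ z) (pdt u z)‖ + (Cχ * ‖u z‖ + Cχ * (c₀ * ‖u z‖)) := by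
    refine (norm_add_le _ _).trans (add_le_add ?_ ((norm_add_le _ _).trans (add_le_add ?_ ?_)))
    · rw [norm_smul, Real.norm_of_nonneg hχ0]
      exact mul_le_of_le_one_left (norm_nonneg _) hχ1
    · rw [norm_smul]
      gcongr
      exact hχd 1 norm_one
    · rw [norm_smul]
      gcongr
      · exact hχd I norm_I
      · exact ((J (φ z)).le_opNorm _).trans (by gcongr; exact hJb _ (hφV hz))
  have n4 := (P.le_opNorm (χ z • (pds u z + J (φ z) (pdt u z)) +
        (fderiv ℝ χ z 1 • u z + fderiv ℝ χ z I • J (φ z) (u z)))).trans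
    (mul_le_mul (norm_PhiMap_le J₀ (hJb _ (hφV hz))) n3 (norm_nonneg _) (by positivity))
  rw [dec]
  refine (norm_add₃_le).trans ((add_le_add_three n1 n2 n4).trans ?_)
  set b := ‖pds u z + J (φ z) (pdt u z)‖
  have hb : 0 ≤ b := norm_nonneg _
  set c := ‖u z‖
  have hc : 0 ≤ c := norm_nonneg _
  have hS0 : 0 ≤ S := Real.sqrt_nonneg _
  set k := ‖J₀‖
  have hk : 0 ≤ k := norm_nonneg _
  have e : (k * c₀ * (1 + k) + (1 + k * c₀) * (1 + Cχ * (1 + c₀))) * (S * c + b + c) -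
      (k * c₀ * (S * c) + k * (k * c₀ * (S * c)) +
        (1 + k * c₀) * (b + (Cχ * c + Cχ * (c₀ * c)))) =
      k * c₀ * (1 + k) * (b + c) + (1 + k * c₀) * (S * c) + (1 + k * c₀) * c +
        (1 + k * c₀) * (Cχ * (1 + c₀)) * (S * c + b) := by ring
  have : 0 ≤ k * c₀ * (1 + k) * (b + c) + (1 + k * c₀) * (S * c) + (1 + k * c₀) * c +
        (1 + k * c₀) * (Cχ * (1 + c₀)) * (S * c + b) := by positivity
  linarith

lemma lipschitzWith_PhiMap_cutoff {n : ℕ} {J₀ : EV n →L[ℝ] EV n}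
    {J : EV n → (EV n →L[ℝ] EV n)} {V : Set (EV n)} {U : Set ℂ} (hU : IsOpen U)
    {c₀ : ℝ} (hc₀ : 0 ≤ c₀) (hJL : LipschitzOnWith (Real.toNNReal c₀) J V)
    {φ u : ℂ → EV n} (hφ : ContDiffOn ℝ 1 φ U) (hφV : MapsTo φ U V) (hu : ContDiffOn ℝ 1 u U)
    {χ : ℂ → ℝ} (hχ : ContDiff ℝ 1 χ) (hs : HasCompactSupport χ) (hχU : tsupport χ ⊆ U) :
    ∃ L, LipschitzWith L fun w => PhiMap J₀ J (φ w) (χ w • u w) := by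
  refine LocallyLipschitz.exists_lipschitzWith_of_hasCompactSupport (fun z => ?_) ?_
  · by_cases hz : z ∈ U
    · have hUz : U ∈ 𝓝 z := hU.mem_nhds hz
      refine locallyLipschitzAt_clm_apply ?_ (hχ.contDiffAt.smul (hu.contDiffAt hUz))
      obtain ⟨K, t, ht, hK⟩ := (hφ.contDiffAt hUz).exists_lipschitzOnWith
      have hP : LipschitzOnWith (‖J₀‖ * c₀).toNNReal (PhiMap J₀ J) V := by
        refine lipschitzOnWith_iff_norm_sub_le.2 fun x hx y hy => ?_
        rw [Real.coe_toNNReal _ (by positivity)]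
        exact norm_PhiMap_sub_le J₀ hc₀ hJL hx hy
      exact ⟨_, _, Filter.inter_mem ht hUz, hP.comp (hK.mono inter_subset_left)
        fun w hw => hφV hw.2⟩
    · have h0 : χ =ᶠ[𝓝 z] 0 := notMem_tsupport_iff_eventuallyEq.1 fun h => hz (hχU h)
      refine ⟨0, _, h0, fun x hx y hy => ?_⟩
      have hx' : χ x = 0 := hx
      have hy' : χ y = 0 := hy
      simp [hx', hy']
  · exact hs.mono' fun z hz => subset_tsupport _ fun h => hz (by simp [h])

/-- **Dbar estimate with twist `Φ`**: `Φ_x J_x = J₀ Φ_x`, and a `W^{1,p}(U')` estimate for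
`(Φ∘φ)·u` in terms of `|dφ||u|`, the `J̃`-Cauchy-Riemann operator applied to `u`, and `u`. -/
theorem dbar_estimate_with_twist (n : ℕ) (U' U : Set ℂ)
    (hU' : IsOpen U') (hU : IsOpen U)
    (hU'b : Bornology.IsBounded U') (hUb : Bornology.IsBounded U)
    (hsub : closure U' ⊆ U)
    (V : Set (EV n)) (hV : IsOpen V)
    (p : ℝ) (hp : 1 < p)
    (J₀ : EV n →L[ℝ] EV n) (hJ₀ : J₀ * J₀ = -1) :
    ∀ c₀ > (0 : ℝ), ∃ c > (0 : ℝ),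
      ∀ J : EV n → (EV n →L[ℝ] EV n),
        (∀ x ∈ V, J x * J x = -1) →
        (∀ x ∈ V, ‖J x‖ ≤ c₀) →
        LipschitzOnWith (Real.toNNReal c₀) J V →
        (∀ x ∈ V, PhiMap J₀ J x * J x = J₀ * PhiMap J₀ J x) ∧
        ∀ (φ : ℂ → EV n) (u : ℂ → EV n),
          ContDiffOn ℝ 1 φ U → MapsTo φ U V → ContDiffOn ℝ 1 u U →
          (∫⁻ z in U', ENNReal.ofReal
              (‖(PhiMap J₀ J (φ z)) (u z)‖ ^ p
                + (Real.sqrt (‖pds (fun w => (PhiMap J₀ J (φ w)) (u w)) z‖ ^ 2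
                    + ‖pdt (fun w => (PhiMap J₀ J (φ w)) (u w)) z‖ ^ 2)) ^ p)) ^ (1 / p)
            ≤ ENNReal.ofReal c *
              ((∫⁻ z in U, ENNReal.ofReal
                  ((Real.sqrt (‖pds φ z‖ ^ 2 + ‖pdt φ z‖ ^ 2) * ‖u z‖) ^ p)) ^ (1 / p)
                + (∫⁻ z in U, ENNReal.ofReal
                    (‖pds u z + (J (φ z)) (pdt u z)‖ ^ p)) ^ (1 / p)
                + (∫⁻ z in U, ENNReal.ofReal (‖u z‖ ^ p)) ^ (1 / p)) := by
  intro c₀ hc₀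
  have hp0 : 0 < p := by linarith
  obtain ⟨χ, hχ, hχs, hχU, hχI, hχ1⟩ := exists_smooth_cutoff hU'b hU hsub
  obtain ⟨Cχ, hCχ⟩ := (hχs.fderiv ℝ).exists_bound_of_continuous
    (hχ.continuous_fderiv one_ne_zero)
  have hCχ0 : 0 ≤ Cχ := (norm_nonneg _).trans (hCχ 0)
  obtain ⟨C, hC, hest⟩ := exists_fderiv_bound hp J₀ hJ₀
  set B := 1 + ‖J₀‖ * c₀ with hB
  have hB0 : 0 < B := by positivity
  set C₁ := ‖J₀‖ * c₀ * (1 + ‖J₀‖) + (1 + ‖J₀‖ * c₀) * (1 + Cχ * (1 + c₀)) with hC₁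
  have hC₁0 : 0 ≤ C₁ := by positivity
  set N := C₁ ^ p * 3 ^ p with hN
  set K := B ^ p + 3 ^ p * (C * N) with hK
  have hN0 : 0 ≤ N := by positivity
  have hK0 : 0 < K := by positivity
  refine ⟨K ^ (1 / p), by positivity, fun J hJ hJb hJL =>
    ⟨fun x hx => PhiMap_mul hJ₀ (hJ x hx), fun φ u hφ hφV hu => ?_⟩⟩
  obtain ⟨L, hL⟩ := lipschitzWith_PhiMap_cutoff (J₀ := J₀) hU hc₀.le hJL hφ hφV hu hχ hχs hχU
  have hpt := fun z (hz : z ∈ U) hv => norm_dbar_PhiMap_le (z := z) hJ₀ hU hc₀.le hJ hJb hJL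
    hφ hφV hu hχ hχI hCχ hz hv
  have hvχ : ∀ z, χ z = 0 → PhiMap J₀ J (φ z) (χ z • u z) = 0 := fun z h => by simp [h]
  have hvU' : ∀ z ∈ U', (fun w => PhiMap J₀ J (φ w) (χ w • u w)) =ᶠ[𝓝 z]
      fun w => PhiMap J₀ J (φ w) (u w) := fun z hz => by
    filter_upwards [hU'.mem_nhds hz] with w hw
    rw [hχ1 w hw, one_smul]
  set v := fun w => PhiMap J₀ J (φ w) (χ w • u w)
  have hvs : HasCompactSupport v :=
    hχs.mono' fun z hz => subset_tsupport _ fun h => hz (hvχ z h)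
  have hvts : tsupport v ⊆ U :=
    (closure_mono (s := Function.support v) (t := Function.support χ)
      fun z hz h => hz (hvχ z h)).trans hχU
  have hest' := hest L v hL hvs
  set a := fun z => Real.sqrt (‖pds φ z‖ ^ 2 + ‖pdt φ z‖ ^ 2) * ‖u z‖ with ha
  set b := fun z => ‖pds u z + (J (φ z)) (pdt u z)‖ with hb
  have ha0 : ∀ z, 0 ≤ a z := fun z => by positivity
  have hb0 : ∀ z, 0 ≤ b z := fun z => norm_nonneg _
  set Ia := ∫⁻ z in U, ENNReal.ofReal (a z ^ p)
  set Ib := ∫⁻ z in U, ENNReal.ofReal (b z ^ p)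
  set Ic := ∫⁻ z in U, ENNReal.ofReal (‖u z‖ ^ p) with hIc
  have um : AEMeasurable u (volume.restrict U) := hu.continuousOn.aemeasurable hU.measurableSet
  have cm : AEMeasurable (fun z => ENNReal.ofReal (‖u z‖ ^ p)) (volume.restrict U) :=
    (um.norm.pow_const p).ennreal_ofReal
  have am : AEMeasurable (fun z => ENNReal.ofReal (a z ^ p)) (volume.restrict U) := by
    have h1 : Measurable (pds φ) := measurable_fderiv_apply_const ℝ φ 1
    have h2 : Measurable (pdt φ) := measurable_fderiv_apply_const ℝ φ I
    exact ((((h1.norm.pow_const 2).add (h2.norm.pow_const 2)).sqrt.aemeasurable.mul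
      um.norm).pow_const p).ennreal_ofReal
  have hD : ∫⁻ x, ENNReal.ofReal (‖fderiv ℝ v x 1 + J₀ (fderiv ℝ v x I)‖ ^ p) ≤
      ENNReal.ofReal N * (Ia + Ib + Ic) := by
    have hz0 : ∀ x, x ∉ U →
        ENNReal.ofReal (‖fderiv ℝ v x 1 + J₀ (fderiv ℝ v x I)‖ ^ p) = 0 := fun x hx => by
      have : fderiv ℝ v x = 0 :=
        image_eq_zero_of_notMem_tsupport fun h => hx (hvts (tsupport_fderiv_subset ℝ h))
      simp [this, hp0.ne']
    calc ∫⁻ x, ENNReal.ofReal (‖fderiv ℝ v x 1 + J₀ (fderiv ℝ v x I)‖ ^ p)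
        = ∫⁻ x in U, ENNReal.ofReal (‖fderiv ℝ v x 1 + J₀ (fderiv ℝ v x I)‖ ^ p) :=
          (setLIntegral_eq_of_support_subset fun x hx => by
            by_contra h
            exact hx (hz0 x h)).symm
      _ ≤ ∫⁻ x in U, ENNReal.ofReal N * (ENNReal.ofReal (a x ^ p) + ENNReal.ofReal (b x ^ p) +
            ENNReal.ofReal (‖u x‖ ^ p)) := by
          refine lintegral_mono_ae ?_
          filter_upwards [ae_restrict_mem hU.measurableSet,
            ae_restrict_of_ae hL.ae_differentiableAt] with x hx hd
          have pa := Real.rpow_nonneg (ha0 x) p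
          have pb := Real.rpow_nonneg (hb0 x) p
          have pc := Real.rpow_nonneg (norm_nonneg (u x)) p
          rw [← ENNReal.ofReal_add pa pb, ← ENNReal.ofReal_add (by positivity) pc,
            ← ENNReal.ofReal_mul hN0]
          refine ENNReal.ofReal_le_ofReal ?_
          refine (Real.rpow_le_rpow (norm_nonneg _) (hpt x hx hd) hp0.le).trans ?_
          have h0 : 0 ≤ a x + b x + ‖u x‖ :=
            add_nonneg (add_nonneg (ha0 x) (hb0 x)) (norm_nonneg _)
          rw [Real.mul_rpow hC₁0 h0, hN, mul_assoc]
          gcongr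
          exact rpow_add_add_le hp0.le (ha0 x) (hb0 x) (norm_nonneg _)
      _ = ENNReal.ofReal N * (Ia + Ib + Ic) := by
          rw [lintegral_const_mul' _ _ ENNReal.ofReal_ne_top, lintegral_add_right' _ cm,
            lintegral_add_left' am]
  have hmain : ∫⁻ z in U', ENNReal.ofReal
              (‖(PhiMap J₀ J (φ z)) (u z)‖ ^ p
                + (Real.sqrt (‖pds (fun w => (PhiMap J₀ J (φ w)) (u w)) z‖ ^ 2
                    + ‖pdt (fun w => (PhiMap J₀ J (φ w)) (u w)) z‖ ^ 2)) ^ p) ≤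
      ENNReal.ofReal K * (Ia + Ib + Ic) := by
    have hU'U : U' ⊆ U := subset_closure.trans hsub
    calc _ ≤ ∫⁻ z in U', (ENNReal.ofReal (B ^ p) * ENNReal.ofReal (‖u z‖ ^ p) +
          ENNReal.ofReal (3 ^ p) *
            ENNReal.ofReal (‖fderiv ℝ v z 1‖ ^ p + ‖fderiv ℝ v z I‖ ^ p)) := by
          refine setLIntegral_mono_ae' hU'.measurableSet (.of_forall fun z hz => ?_)
          have h3 : (0 : ℝ) ≤ 3 ^ p := by positivity
          rw [← ENNReal.ofReal_mul (by positivity), ← ENNReal.ofReal_mul h3,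
            ← ENNReal.ofReal_add (by positivity) (by positivity)]
          refine ENNReal.ofReal_le_ofReal (add_le_add ?_ ?_)
          · rw [← Real.mul_rpow hB0.le (norm_nonneg _)]
            refine Real.rpow_le_rpow (norm_nonneg _) ?_ hp0.le
            refine ((PhiMap J₀ J (φ z)).le_opNorm _).trans ?_
            gcongr
            exact norm_PhiMap_le J₀ (hJb _ (hφV (hU'U hz)))
          · rw [(hvU' z hz).fderiv_eq]
            exact sqrt_sq_add_sq_rpow_le hp0.le (norm_nonneg _) (norm_nonneg _)
      _ = ENNReal.ofReal (B ^ p) * (∫⁻ z in U', ENNReal.ofReal (‖u z‖ ^ p)) +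
          ENNReal.ofReal (3 ^ p) * ∫⁻ z in U',
            ENNReal.ofReal (‖fderiv ℝ v z 1‖ ^ p + ‖fderiv ℝ v z I‖ ^ p) := by
          rw [lintegral_add_left' ((cm.mono_measure (Measure.restrict_mono hU'U le_rfl)).const_mul _),
            lintegral_const_mul' _ _ ENNReal.ofReal_ne_top,
            lintegral_const_mul' _ _ ENNReal.ofReal_ne_top]
      _ ≤ ENNReal.ofReal (B ^ p) * (Ia + Ib + Ic) +
          ENNReal.ofReal (3 ^ p) * (ENNReal.ofReal C * (ENNReal.ofReal N * (Ia + Ib + Ic))) := by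
          gcongr
          · exact (lintegral_mono_set hU'U).trans le_add_self
          · exact (setLIntegral_le_lintegral _ _).trans (hest'.trans (by gcongr))
      _ = ENNReal.ofReal K * (Ia + Ib + Ic) := by
          rw [hK, ENNReal.ofReal_add (by positivity) (by positivity),
            ENNReal.ofReal_mul (p := 3 ^ p) (by positivity), ENNReal.ofReal_mul hC.le]
          ring
  have hp1 : 0 ≤ 1 / p := by positivity
  have hp2 : 1 / p ≤ 1 := by rw [div_le_one hp0]; exact hp.le
  calc _ ≤ (ENNReal.ofReal K * (Ia + Ib + Ic)) ^ (1 / p) := ENNReal.rpow_le_rpow hmain hp1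
    _ = ENNReal.ofReal (K ^ (1 / p)) * (Ia + Ib + Ic) ^ (1 / p) := by
        rw [ENNReal.mul_rpow_of_nonneg _ _ hp1, ENNReal.ofReal_rpow_of_pos hK0]
    _ ≤ _ := by
        gcongr
        refine (ENNReal.rpow_add_le_add_rpow _ _ hp1 hp2).trans ?_
        gcongr
        exact ENNReal.rpow_add_le_add_rpow _ _ hp1 hp2
end
end

section
/- Let M be a set and let C ⊆ M × M^ℕ be a collection of sequences in M satisfying the uniqueness axiom: if (x₀, (xₙ)ₙ) ∈ C and (y₀, (xₙ)ₙ) ∈ C then x₀ = y₀. Suppose that for every x ∈ M there exists a constant ε₀(x) > 0 and, for each 0 < ε < ε₀(x), a function ρ_ε(x, ·) : M → [0, ∞] such that: (i) ρ_ε(x, x) = 0 for all 0 < ε < ε₀(x); (ii) for every x ∈ M, 0 < ε < ε₀(x) and every sequence (xₙ)ₙ in M, one has (x, (xₙ)ₙ) ∈ C if and only if ρ_ε(x, xₙ) → 0 as n → ∞; (iii) for every x ∈ M, 0 < ε < ε₀(x) and every (x', (xₙ)ₙ) ∈ C, if ρ_ε(x, x') < ε then limsup_{n→∞} ρ_ε(x,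 xₙ) ≤ ρ_ε(x, x'). Let U(C) be the topology whose open sets are those U ⊆ M such that every (x₀,(xₙ)ₙ) ∈ C with x₀ ∈ U satisfies xₙ ∈ U for all sufficiently large n. Then: a sequence (xₙ)ₙ converges to x₀ in the topology U(C) if and only if (x₀, (xₙ)ₙ) ∈ C; moreover, the topological space (M, U(C)) is first countable and Hausdorff. -/
open Filter
open scoped ENNReal Topology

noncomputable section

/-- The topology `U(C)` induced by a collection `C` of convergent sequences: a set is
open iff every sequence of `C` whose limit lies in the set eventually lies in it. -/
def seqTopology {M : Type*} (C : Set (M × (ℕ → M))) : TopologicalSpace M where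
  IsOpen U := ∀ p ∈ C, p.1 ∈ U → ∃ N : ℕ, ∀ n ≥ N, p.2 n ∈ U
  isOpen_univ := fun _ _ _ => ⟨0, fun _ _ => trivial⟩
  isOpen_inter := by
    rintro s t hs ht p hp ⟨h1, h2⟩
    obtain ⟨N1, hN1⟩ := hs p hp h1
    obtain ⟨N2, hN2⟩ := ht p hp h2
    exact ⟨max N1 N2, fun n hn =>
      ⟨hN1 n (le_trans (le_max_left _ _) hn), hN2 n (le_trans (le_max_right _ _) hn)⟩⟩
  isOpen_sUnion := by
    intro S hS p hp hx
    obtain ⟨U, hU, hxU⟩ := hx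
    obtain ⟨N, hN⟩ := hS U hU p hp hxU
    exact ⟨N, fun n hn => ⟨U, hU, hN n hn⟩⟩

theorem isOpen_seqTopology_iff {M : Type*} {C : Set (M × (ℕ → M))} {U : Set M} :
    IsOpen[seqTopology C] U ↔ ∀ p ∈ C, p.1 ∈ U → ∃ N : ℕ, ∀ n ≥ N, p.2 n ∈ U :=
  Iff.rfl

theorem tendsto_nhds_seqTopology_of_mem {M : Type*} {C : Set (M × (ℕ → M))} {x : M}
    {s : ℕ → M} (h : (x, s) ∈ C) : Tendsto s atTop (@nhds M (seqTopology C) x) := by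
  let _ : TopologicalSpace M := seqTopology C
  exact tendsto_nhds.2 fun U hU hx =>
    mem_atTop_sets.2 (isOpen_seqTopology_iff.1 hU (x, s) h hx)

/-- If convergence to `x` in `C` is measured by `f`, and the small sublevel sets of `f`
are stable under limits in `C`, then `f` generates the neighbourhoods of `x`. -/
theorem nhds_seqTopology_eq_comap {M : Type*} {C : Set (M × (ℕ → M))} {x : M}
    {f : M → ℝ≥0∞} {r : ℝ≥0∞} (hr : 0 < r) (hfx : f x = 0)
    (hconv : ∀ s : ℕ → M, Tendsto (fun n => f (s n)) atTop (𝓝 0) → (x, s) ∈ C)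
    (hlimsup : ∀ y : M, ∀ s : ℕ → M, (y, s) ∈ C → f y < r →
      limsup (fun n => f (s n)) atTop ≤ f y) :
    @nhds M (seqTopology C) x = comap f (𝓝 0) := by
  let _ : TopologicalSpace M := seqTopology C
  apply le_antisymm
  · rw [← tendsto_iff_comap, ENNReal.nhds_zero_basis.tendsto_right_iff]
    intro δ hδ
    have hopen : IsOpen {y | f y < min δ r} := by
      refine isOpen_seqTopology_iff.2 ?_
      rintro ⟨y, s⟩ hys hy
      have hlt := (hlimsup y s hys (lt_of_lt_of_le hy (min_le_right _ _))).trans_lt hy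
      exact eventually_atTop.1 (eventually_lt_of_limsup_lt hlt)
    filter_upwards [hopen.mem_nhds (show f x < min δ r from hfx ▸ lt_min hδ hr)] with y hy
    exact lt_of_lt_of_le hy (min_le_left _ _)
  · refine tendsto_id'.1 (tendsto_of_seq_tendsto fun s hs => ?_)
    exact tendsto_nhds_seqTopology_of_mem (hconv s (tendsto_comap_iff.1 hs))

/-- A first countable space in which sequences have unique limits is Hausdorff. -/
theorem t2Space_of_forall_seq_tendsto_eq {X : Type*} [TopologicalSpace X]
    [FirstCountableTopology X]
    (h : ∀ (x y : X) (s : ℕ → X), Tendsto s atTop (𝓝 x) → Tendsto s atTop (𝓝 y) → x = y) :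
    T2Space X := by
  refine t2_iff_nhds.2 fun {x y} hxy => ?_
  obtain ⟨s, hs⟩ := exists_seq_tendsto (𝓝 x ⊓ 𝓝 y)
  exact h x y s (hs.mono_right inf_le_left) (hs.mono_right inf_le_right)

/-- **Abstract Gromov topology** (Lem. 5.6.5 of McDuff–Salamon): a collection `C` of
convergent sequences with unique limits, controlled by distance functions
`ρ_ε(x,·) : M → [0,∞]` (for `0 < ε < ε₀(x)`) satisfying (i) `ρ_ε(x,x) = 0`,
(ii) `(x,(xₙ)) ∈ C ↔ ρ_ε(x,xₙ) → 0`, and (iii) the weak triangle inequality, induces a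
topology `U(C)` in which convergence of sequences coincides with membership in `C`, and
which is first countable and Hausdorff. -/
theorem seqTopology_convergence_firstCountable_hausdorff {M : Type*}
    (C : Set (M × (ℕ → M)))
    (huniq : ∀ x₀ y₀ : M, ∀ s : ℕ → M, (x₀, s) ∈ C → (y₀, s) ∈ C → x₀ = y₀)
    (ε₀ : M → ℝ) (hε₀ : ∀ x, 0 < ε₀ x)
    (ρ : M → ℝ → M → ℝ≥0∞)
    (hrefl : ∀ x : M, ∀ ε : ℝ, 0 < ε → ε < ε₀ x → ρ x ε x = 0)
    (hconv : ∀ x : M, ∀ ε : ℝ, 0 < ε → ε < ε₀ x → ∀ s : ℕ → M,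
      ((x, s) ∈ C ↔ Tendsto (fun n => ρ x ε (s n)) atTop (nhds 0)))
    (htriangle : ∀ x : M, ∀ ε : ℝ, 0 < ε → ε < ε₀ x → ∀ x' : M, ∀ s : ℕ → M,
      (x', s) ∈ C → ρ x ε x' < ENNReal.ofReal ε →
      Filter.limsup (fun n => ρ x ε (s n)) atTop ≤ ρ x ε x') :
    (∀ x₀ : M, ∀ s : ℕ → M,
      Filter.Tendsto s atTop (@nhds M (seqTopology C) x₀) ↔ (x₀, s) ∈ C) ∧
    @FirstCountableTopology M (seqTopology C) ∧
    @T2Space M (seqTopology C) := by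
  let _ : TopologicalSpace M := seqTopology C
  have hpos (x : M) : 0 < ε₀ x / 2 := half_pos (hε₀ x)
  have hlt (x : M) : ε₀ x / 2 < ε₀ x := half_lt_self (hε₀ x)
  have hnhds (x : M) : 𝓝 x = comap (ρ x (ε₀ x / 2)) (𝓝 0) :=
    nhds_seqTopology_eq_comap (ENNReal.ofReal_pos.2 (hpos x)) (hrefl x _ (hpos x) (hlt x))
      (fun s => (hconv x _ (hpos x) (hlt x) s).2) (htriangle x _ (hpos x) (hlt x))
  have hmem (x : M) (s : ℕ → M) : Tendsto s atTop (𝓝 x) ↔ (x, s) ∈ C := by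
    rw [hnhds, tendsto_comap_iff, hconv x _ (hpos x) (hlt x)]
    rfl
  have hfirst : FirstCountableTopology M :=
    ⟨fun x => by rw [hnhds]; infer_instance⟩
  exact ⟨hmem, hfirst, t2Space_of_forall_seq_tendsto_eq fun x y s hx hy =>
    huniq x y s ((hmem x s).1 hx) ((hmem y s).1 hy)⟩
end
end
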